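/- arXiv:2505.02404 — 3 statements merged into one kernel-verified Lean document; each statement's English description precedes it below -/
import Mathlib

section
/- Let k₁ = 2 and 2 ≤ t ≤ min(k₂, d). Then for every minimal subset S ⊆ [2]×[k₂], the ideal I_S ⊆ ℂ[X] is radical, i.e., I_S = √(I_S). -/
noncomputable section

open MvPolynomial

namespace CI

/-- The column index set `[k₁] × [k₂]`. -/
abbrev Col (k₁ k₂ : ℕ) := Fin k₁ × Fin k₂

/-- The polynomial ring `ℂ[X]` in the entries of the `d × (k₁k₂)` matrix `X` of
indeterminates `x_{i,(j,ℓ)}`. -/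
abbrev MvP (d k₁ k₂ : ℕ) := MvPolynomial (Fin d × Col k₁ k₂) ℂ

/-- The `r × r` minor of `X` with rows `a` and columns `b`. -/
def minorPoly (d k₁ k₂ r : ℕ) (a : Fin r → Fin d) (b : Fin r → Col k₁ k₂) :
    MvP d k₁ k₂ :=
  (Matrix.of fun i j => (X (a i, b j) : MvP d k₁ k₂)).det

/-- `F_r(X_U)`: the set of all `r × r` minors of the submatrix `X_U`. -/
def minorSet (d k₁ k₂ r : ℕ) (U : Set (Col k₁ k₂)) : Set (MvP d k₁ k₂) :=
  { f | ∃ a : Fin r → Fin d, ∃ b : Fin r → Col k₁ k₂,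
      Function.Injective a ∧ Function.Injective b ∧ (∀ i, b i ∈ U) ∧
      f = minorPoly d k₁ k₂ r a b }

/-- `I_r(X_U)`: the ideal generated by the `r × r` minors of `X_U`. -/
def minorIdeal (d k₁ k₂ r : ℕ) (U : Set (Col k₁ k₂)) : Ideal (MvP d k₁ k₂) :=
  Ideal.span (minorSet d k₁ k₂ r U)

/-- The row slice `R_i = {i} × [k₂]`. -/
def rowSlice (k₁ k₂ : ℕ) (i : Fin k₁) : Set (Col k₁ k₂) := { p | p.1 = i }

/-- The column slice `C_j = [k₁] × {j}`. -/
def colSlice (k₁ k₂ : ℕ) (j : Fin k₂) : Set (Col k₁ k₂) := { p | p.2 = j }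

/-- The conditional independence ideal `𝓘_C = Σ_j I_2(X_{C_j}) + Σ_i I_t(X_{R_i})`. -/
def ciIdeal (d k₁ k₂ t : ℕ) : Ideal (MvP d k₁ k₂) :=
  (⨆ j : Fin k₂, minorIdeal d k₁ k₂ 2 (colSlice k₁ k₂ j)) ⊔
    ⨆ i : Fin k₁, minorIdeal d k₁ k₂ t (rowSlice k₁ k₂ i)

/-- `I_∅ = I_t(X) + Σ_j I_2(X_{C_j})`. -/
def Iempty (d k₁ k₂ t : ℕ) : Ideal (MvP d k₁ k₂) :=
  minorIdeal d k₁ k₂ t Set.univ ⊔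
    ⨆ j : Fin k₂, minorIdeal d k₁ k₂ 2 (colSlice k₁ k₂ j)

/-! ### The case `k₁ = 2`: the ideals `I_S` -/

/-- The column slice `C_j` does not meet `S`. -/
def colOK (k₂ : ℕ) (S : Set (Col 2 k₂)) (j : Fin k₂) : Prop := ∀ i : Fin 2, (i, j) ∉ S

/-- `𝒞(S)`: the union of all column slices not meeting `S`. -/
def CSet (k₂ : ℕ) (S : Set (Col 2 k₂)) : Set (Col 2 k₂) := { p | colOK k₂ S p.2 }

/-- The condition `Z(1,S) ∖ Z(2,S) ≠ ∅` and `Z(2,S) ∖ Z(1,S) ≠ ∅` under which the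
`(t-1)`-minors are included in `F_S`. -/
def tCond (k₂ : ℕ) (S : Set (Col 2 k₂)) : Prop :=
  (∃ ℓ, ((0 : Fin 2), ℓ) ∈ S ∧ ((1 : Fin 2), ℓ) ∉ S) ∧
  (∃ ℓ, ((1 : Fin 2), ℓ) ∈ S ∧ ((0 : Fin 2), ℓ) ∉ S)

/-- The generating set `F_S` of the ideal `I_S` (for `k₁ = 2`). -/
def FSset (d k₂ t : ℕ) (S : Set (Col 2 k₂)) : Set (MvP d 2 k₂) :=
  minorSet d 2 k₂ 1 S ∪
  (⋃ j ∈ { j : Fin k₂ | colOK k₂ S j }, minorSet d 2 k₂ 2 (colSlice 2 k₂ j)) ∪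
  (⋃ _ : tCond k₂ S, minorSet d 2 k₂ (t - 1) (CSet k₂ S)) ∪
  minorSet d 2 k₂ t ((rowSlice 2 k₂ 0 \ S) ∪ CSet k₂ S) ∪
  minorSet d 2 k₂ t ((rowSlice 2 k₂ 1 \ S) ∪ CSet k₂ S)

/-- The ideal `I_S ⊆ ℂ[X]` for `S ⊆ [2] × [k₂]`, generated by `F_S`. -/
def ISIdeal (d k₂ t : ℕ) (S : Set (Col 2 k₂)) : Ideal (MvP d 2 k₂) :=
  Ideal.span (FSset d k₂ t S)

/-- `u = min(|R₁ ∩ S|, |R₂ ∩ S|)`, the first entry of the combinatorial type of `S`. -/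
def uOf (k₂ : ℕ) (S : Set (Col 2 k₂)) : ℕ :=
  min ((rowSlice 2 k₂ 0 ∩ S).ncard) ((rowSlice 2 k₂ 1 ∩ S).ncard)

/-- `v = max(|R₁ ∩ S|, |R₂ ∩ S|)`, the second entry of the combinatorial type of `S`. -/
def vOf (k₂ : ℕ) (S : Set (Col 2 k₂)) : ℕ :=
  max ((rowSlice 2 k₂ 0 ∩ S).ncard) ((rowSlice 2 k₂ 1 ∩ S).ncard)

/-- `S` contains no column slice. -/
def noColumn (k₂ : ℕ) (S : Set (Col 2 k₂)) : Prop :=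
  ∀ j : Fin k₂, ¬ colSlice 2 k₂ j ⊆ S

/-- A subset `S ⊆ [2] × [k₂]` is minimal: `S = ∅`, or `S` contains no column slice,
its combinatorial type `(u,v)` satisfies `1 ≤ u ≤ v ≤ k₂ - t + 1`, and `u + v = k₂`
in case `t = 2`. -/
def minimalSubset (k₂ t : ℕ) (S : Set (Col 2 k₂)) : Prop :=
  S = ∅ ∨ (noColumn k₂ S ∧ 1 ≤ uOf k₂ S ∧ uOf k₂ S ≤ vOf k₂ S ∧
    vOf k₂ S ≤ k₂ - t + 1 ∧ (t = 2 → uOf k₂ S + vOf k₂ S = k₂))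

/-! ### Hypergraphs and their closure -/

/-- The hypergraph `H(S)` on `[k₁] × [k₂]`: its hyperedges are (1) the singletons of
elements of `S`; (2) the 2-subsets of a column slice disjoint from `S`; (3) the
`(t-1)`-subsets of `{i,j} × (NZ(i,S) ∩ NZ(j,S))` for distinct rows `i, j` with
`Z(i,S) ∖ Z(j,S) ≠ ∅` and `Z(j,S) ∖ Z(i,S) ≠ ∅`; (4) the `t`-subsets of a row slice
disjoint from `S`. -/
def HS (k₁ k₂ t : ℕ) (S : Set (Col k₁ k₂)) : Set (Finset (Col k₁ k₂)) :=
  { e | (∃ p ∈ S, e = {p})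
      ∨ (e.card = 2 ∧ (∃ j, ∀ p ∈ e, p.2 = j) ∧ ∀ p ∈ e, p ∉ S)
      ∨ (e.card = t - 1 ∧ ∃ i j : Fin k₁, i ≠ j ∧
           (∃ ℓ, (i, ℓ) ∈ S ∧ (j, ℓ) ∉ S) ∧ (∃ ℓ, (j, ℓ) ∈ S ∧ (i, ℓ) ∉ S) ∧
           ∀ p ∈ e, (p.1 = i ∨ p.1 = j) ∧ (i, p.2) ∉ S ∧ (j, p.2) ∉ S)
      ∨ (e.card = t ∧ (∃ i, ∀ p ∈ e, p.1 = i) ∧ ∀ p ∈ e, p ∉ S) }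

/-- The closure of a hypergraph: iterate the rule "if `{a,b}` and `e` (with `a ∈ e`)
are hyperedges, then add `(e ∖ {a}) ∪ {b}`". -/
inductive HClosure {k₁ k₂ : ℕ} (H : Set (Finset (Col k₁ k₂))) :
    Finset (Col k₁ k₂) → Prop
  | base {e : Finset (Col k₁ k₂)} : e ∈ H → HClosure H e
  | step {e : Finset (Col k₁ k₂)} (a b : Col k₁ k₂) :
      a ∈ e → HClosure H {a, b} → HClosure H e → HClosure H (insert b (e.erase a))

/-- The determinantal ideal of a hypergraph: it is generated by the minors `[A|B]`
with `A ⊆ [d]`, `B` a hyperedge, and `|A| = |B|`. -/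
def hypIdeal (d k₁ k₂ : ℕ) (H : Set (Finset (Col k₁ k₂))) : Ideal (MvP d k₁ k₂) :=
  Ideal.span { f | ∃ e ∈ H, ∃ a : Fin e.card → Fin d, ∃ b : Fin e.card → Col k₁ k₂,
      Function.Injective a ∧ Function.Injective b ∧ (∀ i, b i ∈ e) ∧
      f = minorPoly d k₁ k₂ e.card a b }

/-- The ideal `I_S` associated to the closure of the hypergraph `H(S)`. -/
def ISclosure (d k₁ k₂ t : ℕ) (S : Set (Col k₁ k₂)) : Ideal (MvP d k₁ k₂) :=
  hypIdeal d k₁ k₂ { e | HClosure (HS k₁ k₂ t S) e }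

/-! ### The lexicographic monomial order -/

/-- `varLT a b` means the variable `x_a` is *larger* than `x_b` in the variable order
`x_{1,(1,1)} > x_{2,(1,1)} > ⋯ > x_{d,(1,1)} > x_{1,(2,1)} > ⋯ > x_{d,(k₁,k₂)}`,
i.e. `(ℓ, j, i)` precedes `(ℓ', j', i')` lexicographically, where `a = (i, (j, ℓ))`. -/
def varLT (d k₁ k₂ : ℕ) (a b : Fin d × Col k₁ k₂) : Prop :=
  Prod.Lex (· < ·) (Prod.Lex (· < ·) (· < ·))
    (a.2.2, (a.2.1, a.1)) (b.2.2, (b.2.1, b.1))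

/-- `m ≺ m'` in the lexicographic monomial order determined by the variable order:
at the largest variable where the exponents differ, `m` has the smaller exponent. -/
def monLT (d k₁ k₂ : ℕ) (m m' : (Fin d × Col k₁ k₂) →₀ ℕ) : Prop :=
  ∃ v, (∀ w, varLT d k₁ k₂ w v → m w = m' w) ∧ m v < m' v

/-- `m` is the `≺`-leading monomial of `f`. -/
def IsLeadMon (d k₁ k₂ : ℕ) (f : MvP d k₁ k₂) (m : (Fin d × Col k₁ k₂) →₀ ℕ) : Prop :=
  m ∈ f.support ∧ ∀ m' ∈ f.support, m' = m ∨ monLT d k₁ k₂ m' m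

/-- `G` is a Gröbner basis of `I` with respect to the lexicographic order `≺`:
`G` is contained in `I` and for every nonzero `f ∈ I` there is a `g ∈ G` whose
`≺`-leading monomial divides the `≺`-leading monomial of `f`. -/
def IsGB (d k₁ k₂ : ℕ) (G : Set (MvP d k₁ k₂)) (I : Ideal (MvP d k₁ k₂)) : Prop :=
  G ⊆ (I : Set (MvP d k₁ k₂)) ∧ ∀ f ∈ I, f ≠ 0 →
    ∃ g ∈ G, ∃ mg, IsLeadMon d k₁ k₂ g mg ∧
      ∀ mf, IsLeadMon d k₁ k₂ f mf → ∀ x, mg x ≤ mf x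

/-! ### The matrix `D_A` -/

/-- For `A ∈ ℂ^{k₂ × (k₁-1)}`, the `k₂ × (k₁k₂)` matrix `D_A`: its row `r` has entry
`1` in the column indexed by `(1, r)`, entry `A r ℓ` in the column indexed by
`(1+ℓ, r)` for `ℓ ∈ [k₁-1]`, and zeros elsewhere. -/
def DMat (k₁ k₂ : ℕ) (A : Matrix (Fin k₂) (Fin (k₁ - 1)) ℂ) :
    Matrix (Fin k₂) (Col k₁ k₂) ℂ := fun r c =>
  if c.2 = r then
    (if _h : (c.1 : ℕ) = 0 then 1
     else A r ⟨(c.1 : ℕ) - 1, by have := c.1.isLt; omega⟩)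
  else 0

end CI

namespace CI


theorem isRadical_of_mul_mem {R : Type*} [CommRing R] {I P : Ideal R} {x : R}
    (hIx : (I ⊔ Ideal.span {x}).IsRadical) (hIP : I ≤ P) (hP : P.IsRadical)
    (hxP : ∀ p ∈ P, x * p ∈ I) (hx : ∀ r, x * r ∈ P.radical → r ∈ P.radical) :
    I.IsRadical := by
  intro f hf
  have hf' : f ∈ I ⊔ Ideal.span {x} := hIx (Ideal.radical_mono le_sup_left hf)
  obtain ⟨i, hi, y, hy, rfl⟩ := Submodule.mem_sup.1 hf'
  obtain ⟨r, rfl⟩ := Ideal.mem_span_singleton.1 hy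
  have h1 : x * r ∈ I.radical := by
    have := Ideal.sub_mem _ hf (Ideal.le_radical hi)
    simpa using this
  exact I.add_mem hi (hxP _ (hP (hx r (Ideal.radical_mono hIP h1))))

attribute [local instance] MvPolynomial.gradedAlgebra

theorem homogeneousComponent_succ_X_mul {σ R : Type*} [CommRing R] (v : σ)
    (r : MvPolynomial σ R) (n : ℕ) :
    homogeneousComponent (n + 1) (X v * r) = X v * homogeneousComponent n r := by
  ext m
  classical
  simp only [coeff_homogeneousComponent, coeff_X_mul']
  by_cases hv : v ∈ m.support
  · have h1 : m = Finsupp.single v 1 + (m - Finsupp.single v 1) := by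
      rw [add_tsub_cancel_of_le]
      simpa [Nat.one_le_iff_ne_zero] using hv
    have : m.degree = 1 + (m - Finsupp.single v 1).degree := by
      conv_lhs => rw [h1]
      simp
    simp only [hv, if_true, this]
    simp [add_comm 1]
  · simp [hv]

theorem isRadical_of_isHomogeneous {σ R : Type*} [CommRing R] {P : Ideal (MvPolynomial σ R)}
    (hP : P.IsHomogeneous (homogeneousSubmodule σ R)) (v : σ)
    (hPx : (P ⊔ Ideal.span {X v}).IsRadical)
    (hx : ∀ r, X v * r ∈ P.radical → r ∈ P.radical) : P.IsRadical := by
  have key : ∀ n, ∀ f ∈ P.radical, f.IsHomogeneous n → f ∈ P := by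
    intro n
    induction n with
    | zero =>
      intro f hf hn
      obtain ⟨p, hp, y, hy, h⟩ := Submodule.mem_sup.1 (hPx (Ideal.radical_mono le_sup_left hf))
      obtain ⟨r, rfl⟩ := Ideal.mem_span_singleton.1 hy
      have := congrArg (homogeneousComponent 0) h
      rw [homogeneousComponent_eq_self hn, map_add] at this
      rw [← this]
      refine P.add_mem (homogeneousComponent_mem_of_mem hP hp 0) ?_
      classical
      simp only [homogeneousComponent_zero, coeff_X_mul']
      simp
    | succ n ih =>
      intro f hf hn
      obtain ⟨p, hp, y, hy, h⟩ := Submodule.mem_sup.1 (hPx (Ideal.radical_mono le_sup_left hf))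
      obtain ⟨r, rfl⟩ := Ideal.mem_span_singleton.1 hy
      have := congrArg (homogeneousComponent (n + 1)) h
      rw [homogeneousComponent_eq_self hn, map_add, homogeneousComponent_succ_X_mul] at this
      have hp' := homogeneousComponent_mem_of_mem hP hp (n + 1)
      have h1 : X v * homogeneousComponent n r ∈ P.radical := by
        rw [← add_sub_cancel_left (homogeneousComponent (n + 1) p) (X v * _), this]
        exact Ideal.sub_mem _ hf (Ideal.le_radical hp')
      rw [← this]
      exact P.add_mem hp' (P.mul_mem_left _
        (ih _ (hx _ h1) (homogeneousComponent_isHomogeneous n r)))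
  intro f hf
  rw [mem_iff_homogeneousComponent_mem hP]
  exact fun n => key n _ (homogeneousComponent_mem_of_mem hP.radical hf n)
    (homogeneousComponent_isHomogeneous n f)

theorem finrank_span_cols_lt_iff {ι κ : Type*} [Fintype ι] (M : ι → κ → ℂ) (s : Set κ)
    (q : ℕ) :
    Module.finrank ℂ (Submodule.span ℂ ((fun l a => M a l) '' s)) < q ↔
      ∀ (a : Fin q → ι) (b : Fin q → κ), (∀ k, b k ∈ s) →
        (Matrix.of fun i j => M (a i) (b j)).det = 0 := by
  constructor
  · intro h a b hb
    by_contra hdet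
    have hli : LinearIndependent ℂ (Matrix.of fun i j => M (a i) (b j)).col :=
      Matrix.linearIndependent_cols_iff_isUnit.2
        ((Matrix.isUnit_iff_isUnit_det _).2 (isUnit_iff_ne_zero.2 hdet))
    have hli' : LinearIndependent ℂ (fun j i => M i (b j)) :=
      LinearIndependent.of_comp (LinearMap.funLeft ℂ ℂ a) hli
    have h1 := finrank_span_eq_card hli'
    rw [Fintype.card_fin] at h1
    refine absurd h (not_lt.2 (h1.symm.le.trans (Submodule.finrank_mono (Submodule.span_mono ?_))))
    rintro _ ⟨j, rfl⟩
    exact ⟨b j, hb j, rfl⟩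
  · intro h
    by_contra! hq
    obtain ⟨f, hf, -, hli⟩ := Submodule.exists_fun_fin_finrank_span_eq ℂ ((fun l a => M a l) '' s)
    choose b hb hbf using hf
    set A : Matrix ι (Fin q) ℂ := Matrix.of fun i j => M i (b (Fin.castLE hq j)) with hA
    have hliA : LinearIndependent ℂ A.col := by
      have : A.col = f ∘ Fin.castLE hq := by
        ext j i
        simp [hA, ← hbf, Matrix.col]
      rw [this]
      exact hli.comp _ (Fin.castLE_injective hq)
    have hr : A.rank = q := by
      rw [Matrix.rank_eq_finrank_span_cols, finrank_span_eq_card hliA, Fintype.card_fin]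
    rw [Matrix.rank_eq_finrank_span_row] at hr
    obtain ⟨g, hg, -, hlg⟩ := Submodule.exists_fun_fin_finrank_span_eq ℂ (Set.range A.row)
    choose a ha using hg
    have hdet := h (fun i => a (Fin.castLE hr.ge i)) (fun j => b (Fin.castLE hq j)) fun k => hb _
    have hlg' := hlg.comp _ (Fin.castLE_injective hr.ge)
    have hrow : (Matrix.of fun i j => M (a (Fin.castLE hr.ge i)) (b (Fin.castLE hq j))).row =
        g ∘ Fin.castLE hr.ge := by
      ext i j
      exact congrFun (ha (Fin.castLE hr.ge i)) j
    rw [← hrow, Matrix.linearIndependent_rows_iff_isUnit, Matrix.isUnit_iff_isUnit_det] at hlg'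
    exact hlg'.ne_zero hdet

/-- The minor, with rows `a` and columns `b`, of the generic matrix of variables. -/
noncomputable def genericMinor {κ : Type*} {d q : ℕ} (a : Fin q → Fin d) (b : Fin q → κ) :
    MvPolynomial (Fin d × κ) ℂ :=
  (Matrix.of fun i j => X (a i, b j)).det

/-- The ideal of interval rank conditions. Every `(i, j, q) ∈ Q` contributes the `q`-minors on
the columns whose position lies in `[i, j)`. In addition, the variables in the first `s` rows and
those in row `s` whose column has position less than `m` are set to zero. -/
noncomputable def rankIdeal {κ : Type*} (d : ℕ) (pos : κ → ℕ) (Q : Set (ℕ × ℕ × ℕ)) (s m : ℕ) :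
    Ideal (MvPolynomial (Fin d × κ) ℂ) :=
  Ideal.span ({f | ∃ a l, (a.val < s ∨ a.val = s ∧ pos l < m) ∧ f = X (a, l)} ∪
    {f | ∃ i j q, (i, j, q) ∈ Q ∧ ∃ (a : Fin q → Fin d) (b : Fin q → κ),
      (∀ k, i ≤ pos (b k) ∧ pos (b k) < j) ∧ f = genericMinor a b})

section rankIdeal

variable {κ : Type*} {d : ℕ} {pos : κ → ℕ} {Q : Set (ℕ × ℕ × ℕ)} {s m : ℕ}

theorem X_mem_rankIdeal {a : Fin d} {l : κ} (h : a.val < s ∨ a.val = s ∧ pos l < m) :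
    X (a, l) ∈ rankIdeal d pos Q s m :=
  Ideal.subset_span (Or.inl ⟨a, l, h, rfl⟩)

theorem genericMinor_mem_rankIdeal {i j q : ℕ} (hQ : (i, j, q) ∈ Q) (a : Fin q → Fin d)
    (b : Fin q → κ) (hb : ∀ k, i ≤ pos (b k) ∧ pos (b k) < j) :
    genericMinor a b ∈ rankIdeal d pos Q s m :=
  Ideal.subset_span (Or.inr ⟨i, j, q, hQ, a, b, hb, rfl⟩)

theorem rankIdeal_le_iff {I : Ideal (MvPolynomial (Fin d × κ) ℂ)} :
    rankIdeal d pos Q s m ≤ I ↔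
      (∀ a l, (a.val < s ∨ a.val = s ∧ pos l < m) → X (a, l) ∈ I) ∧
      ∀ i j q, (i, j, q) ∈ Q → ∀ (a : Fin q → Fin d) (b : Fin q → κ),
        (∀ k, i ≤ pos (b k) ∧ pos (b k) < j) → genericMinor a b ∈ I := by
  rw [rankIdeal, Ideal.span_le]
  constructor
  · exact fun h => ⟨fun a l hl => h (Or.inl ⟨a, l, hl, rfl⟩),
      fun i j q hq a b hb => h (Or.inr ⟨i, j, q, hq, a, b, hb, rfl⟩)⟩
  · rintro ⟨h1, h2⟩ f (⟨a, l, hl, rfl⟩ | ⟨i, j, q, hq, a, b, hb, rfl⟩)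
    · exact h1 a l hl
    · exact h2 i j q hq a b hb

theorem isHomogeneous_genericMinor {q : ℕ} (a : Fin q → Fin d) (b : Fin q → κ) :
    (genericMinor a b).IsHomogeneous q := by
  rw [genericMinor, Matrix.det_apply']
  refine IsHomogeneous.sum _ _ _ fun σ _ => ?_
  have h1 : (∏ i, Matrix.of (fun i j => (X (a i, b j) : MvPolynomial (Fin d × κ) ℂ)) (σ i) i
      ).IsHomogeneous (∑ _i : Fin q, 1) :=
    IsHomogeneous.prod _ _ _ fun i _ => isHomogeneous_X _ _
  have h2 : (((Equiv.Perm.sign σ : ℤ) : MvPolynomial (Fin d × κ) ℂ)).IsHomogeneous 0 := by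
    have := isHomogeneous_C (Fin d × κ) ((Equiv.Perm.sign σ : ℤ) : ℂ)
    simpa using this
  simpa using h2.mul h1

theorem isHomogeneous_rankIdeal :
    (rankIdeal d pos Q s m).IsHomogeneous (homogeneousSubmodule (Fin d × κ) ℂ) := by
  refine Ideal.homogeneous_span _ _ ?_
  rintro f (⟨a, l, hl, rfl⟩ | ⟨i, j, q, hq, a, b, hb, rfl⟩)
  · exact ⟨1, isHomogeneous_X _ _⟩
  · exact ⟨q, isHomogeneous_genericMinor a b⟩

/-- The rank conditions satisfied once the entry in the column of position `m` of a row vanishing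
on all columns of smaller position is inverted. -/
def residualConditions (Q : Set (ℕ × ℕ × ℕ)) (m : ℕ) : Set (ℕ × ℕ × ℕ) :=
  Q ∪ {p | p.1 ≤ m ∧ p.2.1 = m ∧ ∃ j, m < j ∧ (p.1, j, p.2.2 + 1) ∈ Q}

theorem rankIdeal_le_residual :
    rankIdeal d pos Q s m ≤ rankIdeal d pos (residualConditions Q m) s m :=
  rankIdeal_le_iff.2 ⟨fun _ _ h => X_mem_rankIdeal h,
    fun _ _ _ hq a b hb => genericMinor_mem_rankIdeal (Or.inl hq) a b hb⟩

theorem X_mul_mem_rankIdeal {a₀ : Fin d} {c : κ} (ha : a₀.val = s) (hc : pos c = m)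
    {p : MvPolynomial (Fin d × κ) ℂ} (hp : p ∈ rankIdeal d pos (residualConditions Q m) s m) :
    X (a₀, c) * p ∈ rankIdeal d pos Q s m := by
  suffices h : rankIdeal d pos (residualConditions Q m) s m ≤
      Submodule.comap (LinearMap.mulLeft (MvPolynomial (Fin d × κ) ℂ) (X (a₀, c)))
        (rankIdeal d pos Q s m) from h hp
  refine rankIdeal_le_iff.2 ⟨fun a l h => Ideal.mul_mem_left _ _ (X_mem_rankIdeal h), ?_⟩
  rintro i j q (hq | ⟨hi, hj, j', hj', hq⟩) a b hb
  · exact Ideal.mul_mem_left _ _ (genericMinor_mem_rankIdeal hq a b hb)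
  · simp only at hi hj hq
    subst hj
    have h1 : genericMinor (Fin.cons a₀ a : Fin (q + 1) → Fin d) (Fin.cons c b) ∈
        rankIdeal d pos Q s j := by
      refine genericMinor_mem_rankIdeal hq _ _ fun k => ?_
      refine Fin.cases ?_ (fun k => ?_) k
      · simp only [Fin.cons_zero]; omega
      · have := hb k
        simp only [Fin.cons_succ]; omega
    rw [genericMinor, Matrix.det_succ_row_zero, Fin.sum_univ_succ] at h1
    rw [Ideal.add_mem_iff_left] at h1
    · simpa [genericMinor, Matrix.submatrix] using h1
    · refine Ideal.sum_mem _ fun k _ => Ideal.mul_mem_right _ _ (Ideal.mul_mem_left _ _ ?_)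
      simpa using X_mem_rankIdeal (Or.inr ⟨ha, (hb k).2⟩)

/-- The span of the columns of `M` whose position lies in `[i, j)`. -/
noncomputable def colSpan (pos : κ → ℕ) (M : Fin d × κ → ℂ) (i j : ℕ) : Submodule ℂ (Fin d → ℂ) :=
  Submodule.span ℂ ((fun l a => M (a, l)) '' {l | i ≤ pos l ∧ pos l < j})

/-- The points of the zero locus of `rankIdeal d pos Q s m`. -/
def IsRankPoint (pos : κ → ℕ) (Q : Set (ℕ × ℕ × ℕ)) (s m : ℕ) (M : Fin d × κ → ℂ) : Prop :=
  (∀ a l, (a.val < s ∨ a.val = s ∧ pos l < m) → M (a, l) = 0) ∧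
    ∀ i j q, (i, j, q) ∈ Q → Module.finrank ℂ (colSpan pos M i j) < q

theorem aeval_genericMinor {q : ℕ} (M : Fin d × κ → ℂ) (a : Fin q → Fin d) (b : Fin q → κ) :
    aeval M (genericMinor a b) = (Matrix.of fun i j => M (a i, b j)).det := by
  rw [genericMinor, AlgHom.map_det]
  congr 1
  ext i j
  simp

theorem mem_zeroLocus_rankIdeal {M : Fin d × κ → ℂ} :
    M ∈ zeroLocus ℂ (rankIdeal d pos Q s m) ↔ IsRankPoint pos Q s m M := by
  have h : M ∈ zeroLocus ℂ (rankIdeal d pos Q s m) ↔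
      rankIdeal d pos Q s m ≤ RingHom.ker (aeval M : _ →ₐ[ℂ] ℂ) := Iff.rfl
  rw [h, rankIdeal_le_iff, IsRankPoint]
  simp only [RingHom.mem_ker, aeval_X, aeval_genericMinor]
  exact and_congr Iff.rfl (forall_congr' fun i => forall_congr' fun j => forall_congr' fun q =>
    imp_congr Iff.rfl (finrank_span_cols_lt_iff (fun a l => M (a, l))
      {l | i ≤ pos l ∧ pos l < j} q).symm)

theorem mem_radical_rankIdeal [Finite κ] {r : MvPolynomial (Fin d × κ) ℂ} :
    r ∈ (rankIdeal d pos Q s m).radical ↔ ∀ M, IsRankPoint pos Q s m M → aeval M r = 0 := by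
  have h := vanishingIdeal_zeroLocus_eq_radical (K := ℂ) (rankIdeal d pos Q s m)
  rw [← h, mem_vanishingIdeal_iff]
  simp only [mem_zeroLocus_rankIdeal]

theorem aeval_eq_zero_of_line {σ : Type*} (r : MvPolynomial σ ℂ) (M M' : σ → ℂ)
    (h : ∀ τ : ℂ, τ ≠ 0 → aeval (fun i => M i + τ * M' i) r = 0) : aeval M r = 0 := by
  have hc : Continuous fun τ : ℂ => eval (fun i => M i + τ * M' i) r :=
    (continuous_eval r).comp (by fun_prop)
  have := hc.ext_on (dense_compl_singleton 0) (continuous_const (y := 0))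
    fun τ hτ => by simpa [aeval_eq_eval] using h τ hτ
  simpa [aeval_eq_eval] using congrFun this 0

theorem mem_colSpan {M : Fin d × κ → ℂ} {i j : ℕ} {l : κ} (hi : i ≤ pos l) (hj : pos l < j) :
    (fun a => M (a, l)) ∈ colSpan pos M i j :=
  Submodule.subset_span ⟨l, ⟨hi, hj⟩, rfl⟩

theorem colSpan_le_iff {M : Fin d × κ → ℂ} {i j : ℕ} {W : Submodule ℂ (Fin d → ℂ)} :
    colSpan pos M i j ≤ W ↔ ∀ l, i ≤ pos l → pos l < j → (fun a => M (a, l)) ∈ W := by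
  rw [colSpan, Submodule.span_le]
  constructor
  · exact fun h l hi hj => h ⟨l, ⟨hi, hj⟩, rfl⟩
  · rintro h _ ⟨l, ⟨hi, hj⟩, rfl⟩
    exact h l hi hj

theorem colSpan_mono {M : Fin d × κ → ℂ} {i i' j j' : ℕ} (hi : i' ≤ i) (hj : j ≤ j') :
    colSpan pos M i j ≤ colSpan pos M i' j' :=
  colSpan_le_iff.2 fun _ h1 h2 => mem_colSpan (hi.trans h1) (h2.trans_le hj)

theorem colSpan_congr {M M' : Fin d × κ → ℂ} {i j : ℕ}
    (h : ∀ a l, pos l < j → M (a, l) = M' (a, l)) : colSpan pos M i j = colSpan pos M' i j := by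
  refine congrArg (Submodule.span ℂ) (Set.image_congr fun l hl => ?_)
  funext a
  exact h a l hl.2

theorem finrank_colSpan_le_of_map {M M' : Fin d × κ → ℂ} {i j : ℕ}
    (g : (Fin d → ℂ) →ₗ[ℂ] (Fin d → ℂ))
    (h : ∀ l, i ≤ pos l → pos l < j → (fun a => M' (a, l)) = g (fun a => M (a, l))) :
    Module.finrank ℂ (colSpan pos M' i j) ≤ Module.finrank ℂ (colSpan pos M i j) := by
  refine le_trans (Submodule.finrank_mono ?_) (Submodule.finrank_map_le g (colSpan pos M i j))
  refine colSpan_le_iff.2 fun l hi hj => ?_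
  rw [h l hi hj]
  exact Submodule.mem_map_of_mem (mem_colSpan hi hj)

/-- Perturbing columns in positions `[m, k)` towards `w` preserves the rank conditions. -/
theorem IsRankPoint.perturb {M : Fin d × κ → ℂ}
    (hM : IsRankPoint pos (residualConditions Q m) s m M) {i k : ℕ} (him : i ≤ m) {w : Fin d → ℂ}
    {μ : κ → ℂ} {f : (Fin d → ℂ) →ₗ[ℂ] ℂ}
    (hcols : ∀ l, m ≤ pos l → pos l < k → (fun a => M (a, l)) ∈ colSpan pos M i m)
    (hw : ∀ a : Fin d, a.val < s → w a = 0)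
    (hk : ∀ l, k ≤ pos l → ∃ l₀, pos l₀ = k ∧ w = fun a => M (a, l₀))
    (hμ : ∀ l, pos l < m ∨ k ≤ pos l → μ l = 0)
    (hμf : ∀ l, i < pos l → pos l < k → μ l = f fun a => M (a, l)) (τ : ℂ) :
    IsRankPoint pos (residualConditions Q m) s m
      (fun p => M p + τ * (μ p.2 * w p.1)) := by
  refine ⟨fun a l h => ?_, fun i' j q hq => ?_⟩
  · simp only
    rw [hM.1 a l h]
    rcases h with h | h
    · simp [hw a h]
    · simp [hμ l (Or.inl h.2)]
  have hrank := hM.2 i' j q hq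
  have hnew : ∀ l, (fun a => M (a, l) + τ * (μ l * w a)) =
      (fun a => M (a, l)) + (τ * μ l) • w := by
    intro l
    funext a
    simp [mul_assoc]
  by_cases hj : j ≤ m
  · refine lt_of_eq_of_lt ?_ hrank
    rw [colSpan_congr]
    intro a l hl
    simp [hμ l (Or.inl (hl.trans_le hj))]
  push Not at hj
  by_cases hA : ∃ l₀, i' ≤ pos l₀ ∧ pos l₀ < j ∧ k ≤ pos l₀
  · obtain ⟨l₀, h1, h2, h3⟩ := hA
    obtain ⟨l₁, h4, rfl⟩ := hk l₀ h3
    refine lt_of_le_of_lt (Submodule.finrank_mono (colSpan_le_iff.2 fun l hl hl' => ?_)) hrank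
    simp only [hnew]
    refine Submodule.add_mem _ (mem_colSpan hl hl') ?_
    by_cases hl0 : μ l = 0
    · simp [hl0]
    · have : pos l < k := by
        by_contra! h
        exact hl0 (hμ l (Or.inr h))
      exact Submodule.smul_mem _ _ (mem_colSpan (by omega) (by omega))
  push Not at hA
  by_cases hi' : i' ≤ i
  · obtain ⟨q, rfl⟩ : ∃ q', q = q' + 1 := ⟨q - 1, by omega⟩
    have hQ : (i', j, q + 1) ∈ Q := by
      rcases hq with hq | ⟨-, h, -⟩
      · exact hq
      · simp only at h; omega
    have hr := hM.2 i' m q (Or.inr ⟨hi'.trans him, rfl, j, hj, hQ⟩)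
    have hle : colSpan pos (fun p => M p + τ * (μ p.2 * w p.1)) i' j ≤
        colSpan pos M i' m ⊔ Submodule.span ℂ {w} := by
      refine colSpan_le_iff.2 fun l hl hl' => ?_
      simp only [hnew]
      refine Submodule.add_mem_sup ?_
        (Submodule.smul_mem _ _ (Submodule.mem_span_singleton_self w))
      by_cases hlm : pos l < m
      · exact mem_colSpan hl hlm
      · exact colSpan_mono hi' le_rfl (hcols l (not_lt.1 hlm) (hA l hl hl'))
    have h1 := Submodule.finrank_mono hle
    have h2 := Submodule.finrank_add_le_finrank_add_finrank (colSpan pos M i' m)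
      (Submodule.span ℂ {w})
    have h3 : Module.finrank ℂ (Submodule.span ℂ {w}) ≤ 1 := by
      simpa using finrank_span_le_card (R := ℂ) ({w} : Set (Fin d → ℂ))
    omega
  · refine lt_of_le_of_lt (finrank_colSpan_le_of_map
      (LinearMap.id + τ • f.smulRight w) fun l hl hl' => ?_) hrank
    rw [hnew, hμf l (by omega) (hA l hl hl')]
    simp [mul_smul]

theorem IsRankPoint.aeval_eq_zero [Finite κ] (hpos : Function.Injective pos) {a₀ : Fin d} {c : κ}
    (ha : a₀.val = s) (hc : pos c = m) {r : MvPolynomial (Fin d × κ) ℂ}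
    (hr : ∀ M, IsRankPoint pos (residualConditions Q m) s m M → M (a₀, c) ≠ 0 → aeval M r = 0)
    {M : Fin d × κ → ℂ} (hM : IsRankPoint pos (residualConditions Q m) s m M) :
    aeval M r = 0 := by
  subst hc
  obtain ⟨B, hB⟩ : ∃ B, ∀ l, pos l < B := by
    obtain ⟨B, hB⟩ := (Set.finite_range pos).bddAbove
    exact ⟨B + 1, fun l => Nat.lt_succ_of_le (hB ⟨l, rfl⟩)⟩
  suffices key : ∀ i, i ≤ pos c + 1 → ∀ M, IsRankPoint pos (residualConditions Q (pos c)) s (pos c) M →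
      (i ≤ pos c → (fun a => M (a, c)) ∉ colSpan pos M i (pos c)) → aeval M r = 0 from
    key (pos c + 1) le_rfl M hM (fun h => absurd h (by omega))
  intro i
  induction i with
  | zero =>
    intro _ M hM hMc
    by_cases h0 : M (a₀, c) = 0
    swap
    · exact hr M hM h0
    obtain ⟨f, hfc, hf⟩ := Submodule.exists_le_ker_of_notMem (hMc (Nat.zero_le _))
    refine aeval_eq_zero_of_line r M
      (fun p => f (fun a => M (a, p.2)) * (Pi.single a₀ 1 : Fin d → ℂ) p.1) fun τ hτ => ?_
    refine hr _ ⟨fun a l hal => ?_, fun i' j q hq => ?_⟩ ?_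
    · simp only
      rw [hM.1 a l hal]
      rcases hal with h | h
      · have : a ≠ a₀ := by rintro rfl; omega
        simp [this]
      · have := hf (mem_colSpan (M := M) (Nat.zero_le _) h.2)
        rw [LinearMap.mem_ker] at this
        simp [this]
    · refine lt_of_le_of_lt (finrank_colSpan_le_of_map
        (LinearMap.id + τ • f.smulRight (Pi.single a₀ 1)) fun l _ _ => ?_) (hM.2 i' j q hq)
      funext a
      simp
    · simp [h0, hτ, hfc]
  | succ i ih =>
    intro hi M hM hMc
    have hi' : i ≤ pos c := by omega
    by_cases hcL : (fun a => M (a, c)) ∈ colSpan pos M i (pos c)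
    swap
    · exact ih (by omega) M hM fun _ => hcL
    obtain ⟨k, w, hck, hwL, hcols, hw, hk⟩ : ∃ (k : ℕ) (w : Fin d → ℂ), pos c < k ∧
        w ∉ colSpan pos M i (pos c) ∧
        (∀ l, pos c ≤ pos l → pos l < k → (fun a => M (a, l)) ∈ colSpan pos M i (pos c)) ∧
        (∀ a : Fin d, a.val < s → w a = 0) ∧
        (∀ l, k ≤ pos l → ∃ l₀, pos l₀ = k ∧ w = fun a => M (a, l₀)) := by
      by_cases hex : ∃ k l, pos l = k ∧ pos c ≤ k ∧ (fun a => M (a, l)) ∉ colSpan pos M i (pos c)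
      · classical
        obtain ⟨l₀, h1, h2, h3⟩ := Nat.find_spec hex
        refine ⟨Nat.find hex, _, lt_of_le_of_ne h2 ?_, h3, fun l hl hlk => ?_,
          fun a h => hM.1 a l₀ (Or.inl h), fun _ _ => ⟨l₀, h1, rfl⟩⟩
        · rintro h
          rw [← h] at h1
          rw [hpos h1] at h3
          exact h3 hcL
        · by_contra h
          exact Nat.find_min hex hlk ⟨l, rfl, hl, h⟩
      · push Not at hex
        refine ⟨B, Pi.single a₀ 1, hB c, fun h => ?_, fun l hl _ => hex _ l rfl hl, fun a h => ?_,
          fun l hl => absurd (hB l) (by omega)⟩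
        · have hle : colSpan pos M i (pos c) ≤ LinearMap.ker (LinearMap.proj a₀ : _ →ₗ[ℂ] ℂ) :=
            colSpan_le_iff.2 fun l _ hl => by
              simpa using hM.1 a₀ l (Or.inr ⟨ha, hl⟩)
          simpa using hle h
        · have : a ≠ a₀ := by rintro rfl; omega
          simp [this]
    obtain ⟨μ, f, hμc, hμ, hμf⟩ : ∃ (μ : κ → ℂ) (f : (Fin d → ℂ) →ₗ[ℂ] ℂ), μ c ≠ 0 ∧
        (∀ l, pos l < pos c ∨ k ≤ pos l → μ l = 0) ∧
        (∀ l, i < pos l → pos l < k → μ l = f fun a => M (a, l)) := by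
      rcases hi'.lt_or_eq with hlt | rfl
      · obtain ⟨f, hfc, hf⟩ := Submodule.exists_le_ker_of_notMem (hMc hlt)
        refine ⟨fun l => if pos c ≤ pos l ∧ pos l < k then f (fun a => M (a, l)) else 0, f,
          by simpa [hck] using hfc, fun l hl => if_neg (by omega), fun l h1 h2 => ?_⟩
        by_cases h : pos c ≤ pos l
        · simp [h, h2]
        · have := hf (mem_colSpan (M := M) (Nat.succ_le_of_lt h1) (not_le.1 h))
          rw [LinearMap.mem_ker] at this
          simp [h, this]
      · classical
        refine ⟨Pi.single c 1, 0, by simp, fun l hl => ?_, fun l h1 _ => ?_⟩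
        · have : l ≠ c := by rintro rfl; omega
          simp [this]
        · have : l ≠ c := by rintro rfl; omega
          simp [this]
    refine aeval_eq_zero_of_line r M (fun p => μ p.2 * w p.1) fun τ hτ => ?_
    refine ih (by omega) _ (hM.perturb hi' hcols hw hk hμ hμf τ) fun _ h => hwL ?_
    rw [colSpan_congr (M' := M) (fun a l hl => by simp [hμ l (Or.inl hl)])] at h
    have h2 := Submodule.sub_mem _ h hcL
    have h3 : (fun a => M (a, c) + τ * (μ c * w a)) - (fun a => M (a, c)) = (τ * μ c) • w := by
      funext a
      simp [mul_assoc]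
    simp only [h3] at h2
    exact (Submodule.smul_mem_iff _ (mul_ne_zero hτ hμc)).1 h2

theorem mem_radical_of_X_mul_mem [Finite κ] (hpos : Function.Injective pos) {a₀ : Fin d} {c : κ}
    (ha : a₀.val = s) (hc : pos c = m) {r : MvPolynomial (Fin d × κ) ℂ}
    (hr : X (a₀, c) * r ∈ (rankIdeal d pos (residualConditions Q m) s m).radical) :
    r ∈ (rankIdeal d pos (residualConditions Q m) s m).radical := by
  rw [mem_radical_rankIdeal] at hr ⊢
  intro M hM
  refine hM.aeval_eq_zero hpos ha hc fun M hM h0 => ?_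
  simpa [h0] using hr M hM

theorem rankIdeal_sup_X (hpos : Function.Injective pos) {a₀ : Fin d} {c : κ}
    (ha : a₀.val = s) (hc : pos c = m) :
    rankIdeal d pos Q s m ⊔ Ideal.span {X (a₀, c)} = rankIdeal d pos Q s (m + 1) := by
  apply le_antisymm
  · refine sup_le (rankIdeal_le_iff.2 ⟨fun a l h => X_mem_rankIdeal (by omega),
      fun _ _ _ hq a b hb => genericMinor_mem_rankIdeal hq a b hb⟩) ?_
    rw [Ideal.span_singleton_le_iff_mem]
    exact X_mem_rankIdeal (by omega)
  · refine rankIdeal_le_iff.2 ⟨fun a l h => ?_, fun _ _ _ hq a b hb =>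
      Ideal.mem_sup_left (genericMinor_mem_rankIdeal hq a b hb)⟩
    by_cases h' : a.val < s ∨ a.val = s ∧ pos l < m
    · exact Ideal.mem_sup_left (X_mem_rankIdeal h')
    · have h1 : a = a₀ := Fin.ext (by omega)
      have h2 : l = c := hpos (by omega)
      subst h1 h2
      exact Ideal.mem_sup_right (Ideal.mem_span_singleton_self _)

theorem isRadical_rankIdeal_of_succ [Finite κ] (hpos : Function.Injective pos) (hs : s < d)
    (h : ∀ Q, (rankIdeal d pos Q s (m + 1)).IsRadical) : (rankIdeal d pos Q s m).IsRadical := by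
  obtain ⟨a₀, ha⟩ : ∃ a₀ : Fin d, a₀.val = s := ⟨⟨s, hs⟩, rfl⟩
  by_cases hc : ∃ c, pos c = m
  · obtain ⟨c, hc⟩ := hc
    have hx : ∀ r : MvPolynomial (Fin d × κ) ℂ,
        X (a₀, c) * r ∈ (rankIdeal d pos (residualConditions Q m) s m).radical →
        r ∈ (rankIdeal d pos (residualConditions Q m) s m).radical := fun r =>
      mem_radical_of_X_mul_mem hpos ha hc
    have hP : (rankIdeal d pos (residualConditions Q m) s m).IsRadical := by
      refine isRadical_of_isHomogeneous isHomogeneous_rankIdeal (a₀, c) ?_ hx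
      rw [rankIdeal_sup_X hpos ha hc]
      exact h _
    refine isRadical_of_mul_mem (x := X (a₀, c)) ?_ rankIdeal_le_residual hP
      (fun p hp => X_mul_mem_rankIdeal ha hc hp) hx
    rw [rankIdeal_sup_X hpos ha hc]
    exact h Q
  · have h1 : ∀ l, pos l < m + 1 ↔ pos l < m := fun l => by
      have := not_exists.1 hc l
      omega
    have : rankIdeal d pos Q s m = rankIdeal d pos Q s (m + 1) := by
      simp only [rankIdeal, h1]
    rw [this]
    exact h Q

theorem isRadical_rankIdeal_of_le (h : d ≤ s) : (rankIdeal d pos Q s m).IsRadical := by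
  intro f hf
  set I := rankIdeal d pos Q s m with hI
  have hX : Ideal.Quotient.mk I = ((Ideal.Quotient.mk I).comp C).comp constantCoeff := by
    refine MvPolynomial.ringHom_ext (fun c => by simp) fun p => ?_
    simpa using Ideal.Quotient.eq_zero_iff_mem.2
      (X_mem_rankIdeal (pos := pos) (Q := Q) (s := s) (m := m) (l := p.2)
        (Or.inl (p.1.isLt.trans_le h)))
  have hfc : f - C (constantCoeff f) ∈ I := Ideal.Quotient.eq.1 (RingHom.congr_fun hX f)
  by_cases h0 : constantCoeff f = 0
  · simpa [h0] using hfc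
  · have h1 : C (constantCoeff f) ∈ I.radical := by
      simpa using Ideal.sub_mem _ hf (Ideal.le_radical hfc)
    have h2 : I = ⊤ := Ideal.radical_eq_top.1
      (Ideal.eq_top_of_isUnit_mem _ h1 ((isUnit_iff_ne_zero.2 h0).map C))
    rw [h2]
    exact Submodule.mem_top

theorem isRadical_rankIdeal [Finite κ] (hpos : Function.Injective pos) :
    (rankIdeal d pos Q s m).IsRadical := by
  obtain ⟨B, hB⟩ : ∃ B, ∀ l, pos l < B := by
    obtain ⟨B, hB⟩ := (Set.finite_range pos).bddAbove
    exact ⟨B + 1, fun l => Nat.lt_succ_of_le (hB ⟨l, rfl⟩)⟩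
  induction hk : d - s generalizing s m Q with
  | zero => exact isRadical_rankIdeal_of_le (by omega)
  | succ k ih =>
    induction hn : B - m generalizing m Q with
    | zero =>
      have h1 : ∀ (a : Fin d) (l : κ), (a.val < s ∨ a.val = s ∧ pos l < m) ↔
          (a.val < s + 1 ∨ a.val = s + 1 ∧ pos l < 0) := fun a l => by
        have := hB l
        omega
      have : rankIdeal d pos Q s m = rankIdeal d pos Q (s + 1) 0 := by
        simp only [rankIdeal, h1]
      rw [this]
      exact ih (by omega)
    | succ n ihn => exact isRadical_rankIdeal_of_succ hpos (by omega) fun Q => ihn (by omega)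

end rankIdeal

section ISIdeal

variable {d k₂ t : ℕ} {S : Set (Col 2 k₂)}

theorem genericMinor_mem_of_minorSet_subset {q : ℕ} {U : Set (Col 2 k₂)}
    {I : Ideal (MvP d 2 k₂)} (h : minorSet d 2 k₂ q U ⊆ I) (a : Fin q → Fin d)
    (b : Fin q → Col 2 k₂) (hb : ∀ k, b k ∈ U) : genericMinor a b ∈ I := by
  by_cases ha : Function.Injective a
  · by_cases hbi : Function.Injective b
    · exact h ⟨a, b, ha, hbi, hb, rfl⟩
    · obtain ⟨i, j, hij, hne⟩ := Function.not_injective_iff.1 hbi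
      rw [genericMinor, Matrix.det_zero_of_column_eq hne fun k => by simp [hij]]
      exact I.zero_mem
  · obtain ⟨i, j, hij, hne⟩ := Function.not_injective_iff.1 ha
    rw [genericMinor, Matrix.det_zero_of_row_eq hne (by ext k; simp [hij])]
    exact I.zero_mem

open Classical in
/-- The block containing a column of `X`: first the columns of `R₁` outside `S` and `𝒞(S)`, then
those of `𝒞(S)`, then those of `R₂` outside `S` and `𝒞(S)`, and finally those of `S`. -/
def colBlock (S : Set (Col 2 k₂)) (p : Col 2 k₂) : ℕ :=
  if p ∈ S then 3 else if colOK k₂ S p.2 then 1 else if p.1 = 0 then 0 else 2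

/-- An ordering of the columns of `X` compatible with the blocks `colBlock`, for which every
column slice is an interval within `𝒞(S)`. -/
def colPos (S : Set (Col 2 k₂)) (p : Col 2 k₂) : ℕ :=
  colBlock S p * (2 * k₂) + (2 * p.2.val + p.1.val)

/-- The interval rank conditions, for the ordering `colPos`, which define `I_S`. -/
def colConditions (k₂ t : ℕ) (S : Set (Col 2 k₂)) : Set (ℕ × ℕ × ℕ) :=
  {(3 * (2 * k₂), 4 * (2 * k₂), 1)} ∪
  {x | ∃ j : Fin k₂, colOK k₂ S j ∧ x = (2 * k₂ + 2 * j.val, 2 * k₂ + 2 * j.val + 2, 2)} ∪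
  {x | tCond k₂ S ∧ x = (2 * k₂, 2 * (2 * k₂), t - 1)} ∪
  {(0, 2 * (2 * k₂), t)} ∪ {(2 * k₂, 3 * (2 * k₂), t)}

theorem colPos_offset_lt (p : Col 2 k₂) : 2 * p.2.val + p.1.val < 2 * k₂ := by omega

theorem colPos_div (p : Col 2 k₂) : colPos S p / (2 * k₂) = colBlock S p := by
  have h := colPos_offset_lt p
  rw [colPos, mul_comm, Nat.mul_add_div (by omega), Nat.div_eq_of_lt h, add_zero]

theorem le_colPos_iff (p : Col 2 k₂) (n : ℕ) : n * (2 * k₂) ≤ colPos S p ↔ n ≤ colBlock S p := by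
  have h := colPos_offset_lt p
  rw [← colPos_div, Nat.le_div_iff_mul_le (by omega)]

theorem colPos_lt_iff (p : Col 2 k₂) (n : ℕ) : colPos S p < n * (2 * k₂) ↔ colBlock S p < n := by
  rw [← not_le, ← not_le, le_colPos_iff]

theorem colPos_injective : Function.Injective (colPos S) := by
  intro p p' h
  have h1 : colBlock S p = colBlock S p' := by rw [← colPos_div, h, colPos_div]
  simp only [colPos, h1] at h
  exact Prod.ext (Fin.ext (by omega)) (Fin.ext (by omega))

theorem three_le_colBlock_iff (p : Col 2 k₂) : 3 ≤ colBlock S p ∧ colBlock S p < 4 ↔ p ∈ S := by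
  unfold colBlock
  split_ifs <;> simp_all

theorem colBlock_eq_one_iff (p : Col 2 k₂) :
    1 ≤ colBlock S p ∧ colBlock S p < 2 ↔ p ∈ CSet k₂ S := by
  have h : colOK k₂ S p.2 → p ∉ S := fun h => h p.1
  unfold colBlock CSet
  split_ifs <;> simp_all

theorem colBlock_lt_two_iff (p : Col 2 k₂) :
    colBlock S p < 2 ↔ p ∈ (rowSlice 2 k₂ 0 \ S) ∪ CSet k₂ S := by
  have h : colOK k₂ S p.2 → p ∉ S := fun h => h p.1
  unfold colBlock CSet rowSlice
  split_ifs <;> simp_all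

theorem one_le_colBlock_iff (p : Col 2 k₂) :
    1 ≤ colBlock S p ∧ colBlock S p < 3 ↔ p ∈ (rowSlice 2 k₂ 1 \ S) ∪ CSet k₂ S := by
  have h : colOK k₂ S p.2 → p ∉ S := fun h => h p.1
  have h1 : p.1 = 1 ↔ ¬ p.1 = 0 := by omega
  unfold colBlock CSet rowSlice
  split_ifs <;> simp_all

theorem colPos_mem_colSlice_iff {j : Fin k₂} (hj : colOK k₂ S j) (p : Col 2 k₂) :
    2 * k₂ + 2 * j.val ≤ colPos S p ∧ colPos S p < 2 * k₂ + 2 * j.val + 2 ↔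
      p ∈ colSlice 2 k₂ j := by
  have hlt := colPos_offset_lt p
  constructor
  · intro h
    have h1 := (le_colPos_iff (S := S) p 1).1 (by omega)
    have h2 := (colPos_lt_iff (S := S) p 2).1 (by omega)
    have h3 : colBlock S p = 1 := by omega
    simp only [colPos, h3] at h
    exact Fin.ext (by omega)
  · rintro rfl
    have h3 : colBlock S p = 1 := by
      have := (colBlock_eq_one_iff (S := S) p).2 hj
      omega
    simp only [colPos, h3]
    omega

theorem ISIdeal_eq_rankIdeal :
    ISIdeal d k₂ t S = rankIdeal d (colPos S) (colConditions k₂ t S) 0 0 := by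
  have e1 : ∀ p, 3 * (2 * k₂) ≤ colPos S p ∧ colPos S p < 4 * (2 * k₂) ↔ p ∈ S := fun p => by
    rw [le_colPos_iff, colPos_lt_iff, three_le_colBlock_iff]
  have e3 : ∀ p, 2 * k₂ ≤ colPos S p ∧ colPos S p < 2 * (2 * k₂) ↔ p ∈ CSet k₂ S := fun p => by
    have h := le_colPos_iff (S := S) p 1
    rw [one_mul] at h
    rw [h, colPos_lt_iff, colBlock_eq_one_iff]
  have e4 : ∀ p, 0 ≤ colPos S p ∧ colPos S p < 2 * (2 * k₂) ↔
      p ∈ (rowSlice 2 k₂ 0 \ S) ∪ CSet k₂ S := fun p => by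
    rw [colPos_lt_iff, colBlock_lt_two_iff, and_iff_right (Nat.zero_le _)]
  have e5 : ∀ p, 2 * k₂ ≤ colPos S p ∧ colPos S p < 3 * (2 * k₂) ↔
      p ∈ (rowSlice 2 k₂ 1 \ S) ∪ CSet k₂ S := fun p => by
    have h := le_colPos_iff (S := S) p 1
    rw [one_mul] at h
    rw [h, colPos_lt_iff, one_le_colBlock_iff]
  apply le_antisymm
  · rw [ISIdeal, Ideal.span_le]
    rintro f ((((hf | hf) | hf) | hf) | hf)
    · obtain ⟨a, b, -, -, hb, rfl⟩ := hf
      exact genericMinor_mem_rankIdeal (Or.inl (Or.inl (Or.inl (Or.inl rfl)))) a b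
        fun k => (e1 _).2 (hb k)
    · simp only [Set.mem_iUnion] at hf
      obtain ⟨j, hj, a, b, -, -, hb, rfl⟩ := hf
      exact genericMinor_mem_rankIdeal (Or.inl (Or.inl (Or.inl (Or.inr ⟨j, hj, rfl⟩)))) a b
        fun k => (colPos_mem_colSlice_iff hj _).2 (hb k)
    · simp only [Set.mem_iUnion] at hf
      obtain ⟨ht, a, b, -, -, hb, rfl⟩ := hf
      exact genericMinor_mem_rankIdeal (Or.inl (Or.inl (Or.inr ⟨ht, rfl⟩))) a b
        fun k => (e3 _).2 (hb k)
    · obtain ⟨a, b, -, -, hb, rfl⟩ := hf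
      exact genericMinor_mem_rankIdeal (Or.inl (Or.inr rfl)) a b fun k => (e4 _).2 (hb k)
    · obtain ⟨a, b, -, -, hb, rfl⟩ := hf
      exact genericMinor_mem_rankIdeal (Or.inr rfl) a b fun k => (e5 _).2 (hb k)
  · rw [rankIdeal_le_iff]
    refine ⟨fun a l h => by omega, ?_⟩
    have hF : FSset d k₂ t S ⊆ ISIdeal d k₂ t S := Ideal.subset_span
    rintro i j q ((((h | ⟨j, hj, h⟩) | ⟨ht, h⟩) | h) | h) a b hb <;> cases h
    · refine genericMinor_mem_of_minorSet_subset (U := S) (fun f hf => hF ?_) a b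
        fun k => (e1 _).1 (hb k)
      exact Or.inl (Or.inl (Or.inl (Or.inl hf)))
    · refine genericMinor_mem_of_minorSet_subset (U := colSlice 2 k₂ j) (fun f hf => hF ?_) a b
        fun k => (colPos_mem_colSlice_iff hj _).1 (hb k)
      exact Or.inl (Or.inl (Or.inl (Or.inr (Set.mem_biUnion hj hf))))
    · refine genericMinor_mem_of_minorSet_subset (U := CSet k₂ S) (fun f hf => hF ?_) a b
        fun k => (e3 _).1 (hb k)
      exact Or.inl (Or.inl (Or.inr (Set.mem_iUnion.2 ⟨ht, hf⟩)))
    · exact genericMinor_mem_of_minorSet_subset (fun f hf => hF (Or.inl (Or.inr hf))) a b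
        fun k => (e4 _).1 (hb k)
    · exact genericMinor_mem_of_minorSet_subset (fun f hf => hF (Or.inr hf)) a b
        fun k => (e5 _).1 (hb k)

end ISIdeal

/-- for `k₁ = 2` and `2 ≤ t ≤ min(k₂, d)`, the ideal `I_S` is
radical for every minimal subset `S ⊆ [2]×[k₂]`. -/
theorem ISIdeal_radical_of_minimalSubset
    (d k₂ t : ℕ) (ht : 2 ≤ t) (htk : t ≤ k₂) (htd : t ≤ d)
    (S : Set (Col 2 k₂)) (hS : minimalSubset k₂ t S) :
    (ISIdeal d k₂ t S).radical = ISIdeal d k₂ t S := by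
  rw [ISIdeal_eq_rankIdeal]
  exact (isRadical_rankIdeal colPos_injective).radical

end CI
end
end

section
/- Let 2 ≤ k₁ and 2 ≤ t ≤ min(k₂, d). Then the ideal I_∅ = I_t(X) + Σ_{j∈[k₂]} I_2(X_{C_j}) of ℂ[X] is prime. -/
noncomputable section

open MvPolynomial

namespace CI

open Finset in
theorem card_filter_eq_sum_card_fiber {κ γ : Type*} [Fintype κ] [Fintype γ] [DecidableEq γ]
    (f : κ → γ) (R : γ → Prop) [DecidablePred R] :
    #{k | R (f k)} = ∑ z with R z, #{k | f k = z} := by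
  rw [card_eq_sum_card_fiberwise (f := f) (t := ({z | R z} : Finset γ))
    (fun k hk => by simpa using hk)]
  refine sum_congr rfl fun z hz => ?_
  congr 1
  ext k
  simp only [mem_filter, mem_univ, true_and] at hz ⊢
  exact ⟨fun h => h.2, fun h => ⟨h ▸ hz, h⟩⟩

open Finset in
theorem card_filter_eq_of_card_fiber_eq {κ κ' γ : Type*} [Fintype κ] [Fintype κ'] [Finite γ]
    [DecidableEq γ] {f : κ → γ} {f' : κ' → γ}
    (h : ∀ y, #{k | f k = y} = #{k | f' k = y}) (R : γ → Prop) [DecidablePred R] :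
    #{k | R (f k)} = #{k | R (f' k)} := by
  have := Fintype.ofFinite γ
  rw [card_filter_eq_sum_card_fiber f, card_filter_eq_sum_card_fiber f',
    sum_congr rfl fun z _ => h z]

open Finset in
/-- A finite multiset in a poset is determined by the sizes of its principal up-sets. -/
theorem card_fiber_eq_of_card_le_eq {κ κ' γ : Type*} [Fintype κ] [Fintype κ'] [Finite γ]
    [PartialOrder γ] [DecidableEq γ] [DecidableLE γ] {f : κ → γ} {f' : κ' → γ}
    (h : ∀ y, #{k | y ≤ f k} = #{k | y ≤ f' k}) (y : γ) :
    #{k | f k = y} = #{k | f' k = y} := by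
  classical
  have := Fintype.ofFinite γ
  induction y using WellFoundedGT.induction with
  | ind y ih =>
    have h1 : ({z | y ≤ z} : Finset γ) = insert y ({z | y < z} : Finset γ) := by
      ext z
      simp [le_iff_eq_or_lt, eq_comm]
    have h2 := h y
    rw [card_filter_eq_sum_card_fiber f, card_filter_eq_sum_card_fiber f', h1,
      sum_insert (by simp), sum_insert (by simp),
      sum_congr rfl fun z hz => ih z (by simpa using hz)] at h2
    omega

open Finset in
theorem card_inter_le_card_inter {κ κ' : Type*} [DecidableEq κ] [DecidableEq κ']
    {A B W V : Finset κ} {A' B' W' V' : Finset κ'}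
    (hBV : B ⊆ V) (hWB' : W' ⊆ B') (hBV' : B' ⊆ V')
    (hW : #(A ∩ W) ≤ #(A' ∩ W')) (hV : #(A ∩ V) ≤ #(A' ∩ V'))
    (hB : #B = #B') (hVV : #V = #V')
    (h : ∀ x ∈ A, x ∈ B → x ∉ W → V \ B ⊆ A) : #(A ∩ B) ≤ #(A' ∩ B') := by
  by_cases h1 : ∃ x ∈ A, x ∈ B ∧ x ∉ W
  · obtain ⟨x, hxA, hxB, hxW⟩ := h1
    have h2 := h x hxA hxB hxW
    have e1 : #(A ∩ V) = #(A ∩ B) + #(V \ B) := by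
      rw [← card_union_of_disjoint]
      · congr 1
        ext z
        have := @hBV z
        have := @h2 z
        simp only [mem_inter, mem_union, mem_sdiff] at *
        tauto
      · exact disjoint_sdiff.mono_left inter_subset_right
    have e2 : #(A' ∩ V') ≤ #(A' ∩ B') + #(V' \ B') := by
      refine (card_le_card ?_).trans (card_union_le _ _)
      intro z
      simp only [mem_inter, mem_union, mem_sdiff]
      tauto
    have e3 := card_sdiff_add_card_eq_card hBV
    have e4 := card_sdiff_add_card_eq_card hBV'
    omega
  · push Not at h1
    calc #(A ∩ B) ≤ #(A ∩ W) := card_le_card fun z hz => by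
          rw [mem_inter] at hz ⊢
          exact ⟨hz.1, h1 z hz.1 hz.2⟩
      _ ≤ #(A' ∩ W') := hW
      _ ≤ #(A' ∩ B') := card_le_card (inter_subset_inter_left hWB')

/-- If a transitive relation has no chain of `n + 1` elements, its elements can be coloured with
`n` colours so that related elements have different colours. -/
theorem exists_coloring_of_no_chain {κ : Type*} (r : κ → κ → Prop) [IsTrans κ r] (n : ℕ)
    (h : ∀ q : Fin (n + 1) → κ, ¬ ∀ a b, a < b → r (q a) (q b)) :
    ∃ c : κ → Fin n, ∀ k k', r k k' → c k ≠ c k' := by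
  classical
  let ch : ℕ → κ → Prop := fun m k =>
    ∃ q : Fin (m + 1) → κ, (∀ a b, a < b → r (q a) (q b)) ∧ q (Fin.last m) = k
  have hlt : ∀ m k, ch m k → m < n := by
    rintro m k ⟨q, hq, -⟩
    by_contra! hmn
    exact h (q ∘ Fin.castLE (by omega)) fun a b hab => hq _ _ hab
  have hzero : ∀ k, ch 0 k := fun k =>
    ⟨fun _ => k, fun a b hab => absurd hab (by omega), rfl⟩
  have hsucc : ∀ m k k', ch m k → r k k' → ch (m + 1) k' := by
    rintro m k k' ⟨q, hq, rfl⟩ hr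
    refine ⟨Fin.snoc q k', fun a b hab => ?_, by simp⟩
    induction b using Fin.lastCases with
    | last =>
      induction a using Fin.lastCases with
      | last => exact absurd hab (lt_irrefl _)
      | cast a =>
        simp only [Fin.snoc_castSucc, Fin.snoc_last]
        rcases (Fin.le_last a).eq_or_lt with rfl | ha
        · exact hr
        · exact _root_.trans (hq _ _ ha) hr
    | cast b =>
      induction a using Fin.lastCases with
      | last => exact absurd hab (not_lt.mpr (Fin.le_last _))
      | cast a =>
        simp only [Fin.snoc_castSucc]
        exact hq _ _ (by simpa using hab)
  have hspec : ∀ k, ch (Nat.findGreatest (fun m => ch m k) n) k := fun k =>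
    Nat.findGreatest_spec (P := fun m => ch m k) (Nat.zero_le n) (hzero k)
  refine ⟨fun k => ⟨Nat.findGreatest (fun m => ch m k) n, hlt _ _ (hspec k)⟩,
    fun k k' hr heq => ?_⟩
  have h1 := hsucc _ _ _ (hspec k) hr
  have h2 := Nat.le_findGreatest (P := fun m => ch m k') (hlt _ _ h1).le h1
  have h3 := congrArg Fin.val heq
  simp only at h3
  omega


/-- The entries of `X` ordered by row and, within a row, lexicographically by column, with the
slice `ℓ` of the column `(j, ℓ)` dominant. -/
def entryPos {d k₁ k₂ : ℕ} (x : Fin d × Col k₁ k₂) : Fin d × (Fin k₂ ×ₗ Fin k₁) :=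
  (x.1, toLex (x.2.2, x.2.1))

theorem entryPos_injective {d k₁ k₂ : ℕ} :
    Function.Injective (entryPos : Fin d × Col k₁ k₂ → _) := by
  rintro ⟨i, j, l⟩ ⟨i', j', l'⟩ h
  simp only [entryPos, Prod.mk.injEq, toLex_inj] at h
  obtain ⟨rfl, rfl, rfl⟩ := h
  rfl

open Finset in
/-- Among all arrangements with the same marginals, one which is antitone within every colour class
and within every slice has the smallest up-sets. -/
theorem card_le_entryPos_le {d k₁ k₂ n : ℕ} {κ κ' : Type*} [Fintype κ] [Fintype κ']
    {p : κ → Fin d × Col k₁ k₂} {c : κ → Fin n} {p' : κ' → Fin d × Col k₁ k₂} {c' : κ' → Fin n}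
    (hA : ∀ y, #{k | ((p k).1, c k) = y} = #{k | ((p' k).1, c' k) = y})
    (hB : ∀ y, #{k | (c k, (p k).2.2) = y} = #{k | (c' k, (p' k).2.2) = y})
    (hC : ∀ y, #{k | (p k).2 = y} = #{k | (p' k).2 = y})
    (h1 : ∀ k k', c k = c k' → (p k).1 < (p k').1 → ¬ (p k).2.2 < (p k').2.2)
    (h2 : ∀ k k', (p k).2.2 = (p k').2.2 → (p k).1 < (p k').1 → ¬ (p k).2.1 < (p k').2.1)
    (y : Fin d × (Fin k₂ ×ₗ Fin k₁)) :
    #{k | y ≤ entryPos (p k)} ≤ #{k | y ≤ entryPos (p' k)} := by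
  classical
  have key : ∀ (a : Fin d) (U : Fin k₂ → Prop) [DecidablePred U], (∀ l l', l ≤ l' → U l → U l') →
      #{k | a ≤ (p k).1 ∧ U (p k).2.2} ≤ #{k | a ≤ (p' k).1 ∧ U (p' k).2.2} := by
    intro a U _ hU
    rw [card_eq_sum_card_fiberwise (f := c) (t := univ) (by simp),
      card_eq_sum_card_fiberwise (f := c') (t := univ) (by simp)]
    refine sum_le_sum fun s _ => ?_
    have := card_inter_le_card_inter (A := {k | a ≤ (p k).1 ∧ c k = s})
      (B := {k | c k = s ∧ U (p k).2.2}) (W := ∅) (V := {k | c k = s})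
      (A' := {k | a ≤ (p' k).1 ∧ c' k = s})
      (B' := {k | c' k = s ∧ U (p' k).2.2}) (W' := ∅) (V' := {k | c' k = s})
      (fun k => by simp +contextual) (by simp) (fun k => by simp +contextual) (by simp)
      (by
        have := card_filter_eq_of_card_fiber_eq hA (fun z => a ≤ z.1 ∧ z.2 = s)
        rw [inter_eq_left.mpr (fun k => by simp), inter_eq_left.mpr (fun k => by simp)]
        exact this.le)
      (card_filter_eq_of_card_fiber_eq hB (fun z => z.1 = s ∧ U z.2))
      (card_filter_eq_of_card_fiber_eq hB (fun z => z.1 = s))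
      (by
        intro k hkA hkB _ k' hk'
        simp only [mem_filter, mem_univ, true_and, mem_sdiff, not_and] at *
        refine ⟨?_, hk'.1⟩
        by_contra! hlt
        refine h1 k' k (hk'.1.trans hkB.1.symm) (hlt.trans_le hkA.1) ?_
        by_contra! hle
        exact hk'.2 hk'.1 (hU _ _ hle hkB.2))
    convert this using 2 <;>
    · ext k
      grind
  obtain ⟨a, z⟩ := y
  obtain ⟨⟨l, j⟩, rfl⟩ := toLex.surjective z
  have hle : ∀ x : Fin d × Col k₁ k₂,
      (a, toLex (l, j)) ≤ entryPos x ↔ a ≤ x.1 ∧ (l < x.2.2 ∨ l = x.2.2 ∧ j ≤ x.2.1) := by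
    intro x
    rw [entryPos, Prod.mk_le_mk, Prod.Lex.toLex_le_toLex]
  have := card_inter_le_card_inter (A := {k | a ≤ (p k).1})
    (B := {k | l < (p k).2.2 ∨ l = (p k).2.2 ∧ j ≤ (p k).2.1})
    (W := {k | l < (p k).2.2}) (V := {k | l ≤ (p k).2.2})
    (A' := {k | a ≤ (p' k).1})
    (B' := {k | l < (p' k).2.2 ∨ l = (p' k).2.2 ∧ j ≤ (p' k).2.1})
    (W' := {k | l < (p' k).2.2}) (V' := {k | l ≤ (p' k).2.2})
    (fun k => by simp only [mem_filter, mem_univ, true_and]; grind)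
    (fun k => by simp only [mem_filter, mem_univ, true_and]; grind)
    (fun k => by simp only [mem_filter, mem_univ, true_and]; grind)
    (by simpa only [filter_and] using key a (l < ·) fun _ _ h h' => h'.trans_le h)
    (by simpa only [filter_and] using key a (l ≤ ·) fun _ _ h h' => h'.trans h)
    (card_filter_eq_of_card_fiber_eq hC (fun z => l < z.2 ∨ l = z.2 ∧ j ≤ z.1))
    (card_filter_eq_of_card_fiber_eq hC (fun z => l ≤ z.2))
    (by
      intro k hkA hkB hkW k' hk'
      simp only [mem_filter, mem_univ, true_and, mem_sdiff] at *
      by_contra! hlt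
      have e1 : l = (p k).2.2 ∧ j ≤ (p k).2.1 := hkB.resolve_left hkW
      have e2 : l = (p k').2.2 ∧ (p k').2.1 < j := by grind
      exact h2 k' k (e2.1.symm.trans e1.1) (hlt.trans_le hkA) (e2.2.trans_le e1.2))
  rw [← filter_and, ← filter_and] at this
  simpa only [hle] using this

open Finset in
/-- The number of positions weakly below an entry; the associated weight of monomials
decreases when a product of diagonal entries is rewritten using the vanishing of a minor. -/
def entryRank {d k₁ k₂ : ℕ} (x : Fin d × Col k₁ k₂) : ℕ :=
  #{y : Fin d × (Fin k₂ ×ₗ Fin k₁) | y ≤ entryPos x}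

open Finset in
theorem sum_entryRank {d k₁ k₂ : ℕ} {κ : Type*} [Fintype κ] (p : κ → Fin d × Col k₁ k₂) :
    ∑ k, entryRank (p k) = ∑ y, #{k | y ≤ entryPos (p k)} :=
  sum_card_bipartiteAbove_eq_sum_card_bipartiteBelow (s := univ) (t := univ)
    fun k y => y ≤ entryPos (p k)

theorem eq_one_of_strictMono_perm {r : ℕ} (σ : Equiv.Perm (Fin r)) (h : StrictMono σ) : σ = 1 := by
  have : (h.orderIsoOfSurjective _ σ.surjective) = OrderIso.refl _ := Subsingleton.elim _ _
  ext i
  exact congrArg Fin.val (DFunLike.congr_fun this i)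

open Finset in
theorem sum_entryRank_perm_lt {d k₁ k₂ r : ℕ} {a : Fin r → Fin d} {b : Fin r → Col k₁ k₂}
    (ha : StrictMono a) (hb : StrictMono fun i => toLex ((b i).2, (b i).1))
    {σ : Equiv.Perm (Fin r)} (hσ : σ ≠ 1) :
    ∑ i, entryRank (a (σ i), b i) < ∑ i, entryRank (a i, b i) := by
  have hrank : ∀ i c, entryRank (i, c) = #{y : Fin d | y ≤ i} *
      #{y : Fin k₂ ×ₗ Fin k₁ | y ≤ toLex (c.2, c.1)} := by
    intro i c
    rw [entryRank, ← card_product, ← filter_product, univ_product_univ]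
    rfl
  have hmono : ∀ {γ : Type} [Fintype γ] [LinearOrder γ],
      StrictMono fun z : γ => #{y : γ | y ≤ z} := by
    intro γ _ _ z z' h
    refine card_lt_card ⟨fun y hy => ?_, fun hsub => ?_⟩
    · simp only [mem_filter, mem_univ, true_and] at hy ⊢
      exact hy.trans h.le
    · have := @hsub z' (by simp)
      simp only [mem_filter, mem_univ, true_and] at this
      exact absurd h this.not_gt
  have hf := hmono.comp ha
  have hg := hmono.comp hb
  simp only [hrank]
  refine (Monovary.sum_comp_perm_mul_lt_sum_mul_iff
    (f := fun i => #{y : Fin d | y ≤ a i})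
    (g := fun i => #{y : Fin k₂ ×ₗ Fin k₁ | y ≤ toLex ((b i).2, (b i).1)})
    (fun i j hij => hf.monotone (hg.lt_iff_lt.mp hij).le)).mpr fun hmv => hσ ?_
  refine eq_one_of_strictMono_perm σ (Monotone.strictMono_of_injective ?_ σ.injective)
  intro i j hij
  rcases hij.eq_or_lt with rfl | hij
  · exact le_rfl
  · exact hf.le_iff_le.mp (hmv (hg hij))


theorem exists_fin_sum_single_eq {σ : Type*} (m : σ →₀ ℕ) :
    ∃ (N : ℕ) (p : Fin N → σ), ∑ k, Finsupp.single (p k) 1 = m := by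
  classical
  refine ⟨_, m.toMultiset.toList.get, ?_⟩
  have h := Fin.sum_univ_fun_getElem m.toMultiset.toList (fun x => (Finsupp.single x 1 : σ →₀ ℕ))
  refine h.trans ?_
  rw [← Multiset.sum_coe, ← Multiset.map_coe, Multiset.coe_toList]
  simp only [Finsupp.toMultiset_map, Finsupp.sum_toMultiset]
  rw [Finsupp.sum_mapDomain_index (by simp) (by simp [add_smul])]
  simp

open Finset in
theorem sum_single_one_apply {κ σ : Type*} [Fintype κ] [DecidableEq σ] (p : κ → σ) (x : σ) :
    (∑ k, Finsupp.single (p k) 1 : σ →₀ ℕ) x = #{k | p k = x} := by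
  simp [Finsupp.finsetSum_apply, Finsupp.single_apply]

/-- A monomial with no diagonal pair inside a column slice and no chain of `t` entries with
strictly increasing rows and slices. -/
def IsStd {d k₁ k₂ : ℕ} (t : ℕ) (m : Fin d × Col k₁ k₂ →₀ ℕ) : Prop :=
  (∀ x ∈ m.support, ∀ y ∈ m.support, x.2.2 = y.2.2 → x.1 < y.1 → ¬ x.2.1 < y.2.1) ∧
  ∀ q : Fin t → Fin d × Col k₁ k₂, (∀ a, q a ∈ m.support) →
    ¬ ∀ a b, a < b → (q a).1 < (q b).1 ∧ (q a).2.2 < (q b).2.2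

theorem monomial_mem_of_minorPoly_mem {d k₁ k₂ r : ℕ} {I : Ideal (MvP d k₁ k₂)}
    {V : Submodule ℂ (MvP d k₁ k₂)} (hIV : I.restrictScalars ℂ ≤ V)
    {q : Fin r → Fin d × Col k₁ k₂} (ha : StrictMono fun i => (q i).1)
    (hb : StrictMono fun i => toLex ((q i).2.2, (q i).2.1))
    (hI : minorPoly d k₁ k₂ r (fun i => (q i).1) (fun i => (q i).2) ∈ I)
    {m : Fin d × Col k₁ k₂ →₀ ℕ} (hq : ∀ i, q i ∈ m.support)
    (hV : ∀ m', Finsupp.weight entryRank m' < Finsupp.weight entryRank m → monomial m' 1 ∈ V) :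
    monomial m 1 ∈ V := by
  classical
  have hinj : Function.Injective q := fun i j h => ha.injective (congrArg Prod.fst h)
  have hle : ∑ i, Finsupp.single (q i) 1 ≤ m := by
    intro x
    rw [sum_single_one_apply]
    by_cases hx : ∃ i, q i = x
    · obtain ⟨i, rfl⟩ := hx
      have h1 := hq i
      rw [Finsupp.mem_support_iff] at h1
      refine le_trans ?_ (Nat.one_le_iff_ne_zero.mpr h1)
      refine Finset.card_le_one.mpr fun a ha b hb => ?_
      simp only [Finset.mem_filter, Finset.mem_univ, true_and] at ha hb
      exact hinj (ha.trans hb.symm)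
    · push Not at hx
      simp [hx]
  obtain ⟨m₀, rfl⟩ := exists_add_of_le hle
  let E : Equiv.Perm (Fin r) → (Fin d × Col k₁ k₂ →₀ ℕ) := fun σ =>
    ∑ i, Finsupp.single ((q (σ i)).1, (q i).2) 1
  have hexp : monomial m₀ 1 * minorPoly d k₁ k₂ r (fun i => (q i).1) (fun i => (q i).2) =
      ∑ σ : Equiv.Perm (Fin r), ((Equiv.Perm.sign σ : ℤ) : ℂ) • monomial (E σ + m₀) (1 : ℂ) := by
    rw [minorPoly, Matrix.det_apply', Finset.mul_sum]
    refine Finset.sum_congr rfl fun σ _ => ?_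
    have : ∏ i, (X ((q (σ i)).1, (q i).2) : MvP d k₁ k₂) = monomial (E σ) 1 := by
      rw [monomial_sum_one]
      rfl
    simp only [Matrix.of_apply]
    rw [this, add_comm (E σ), ← mul_one (1 : ℂ), ← monomial_mul, mul_one,
      MvPolynomial.smul_eq_C_mul]
    simp only [map_intCast]
    ring
  have hmem : ∑ σ : Equiv.Perm (Fin r),
      ((Equiv.Perm.sign σ : ℤ) : ℂ) • monomial (E σ + m₀) (1 : ℂ) ∈ V := by
    rw [← hexp]
    exact hIV (I.mul_mem_left _ hI)
  rw [← Finset.add_sum_erase _ _ (Finset.mem_univ 1)] at hmem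
  rw [V.add_mem_iff_left] at hmem
  · simpa [E] using hmem
  · refine V.sum_mem fun σ hσ => V.smul_mem _ (hV _ ?_)
    rw [map_add, map_add, add_lt_add_iff_right, map_sum, map_sum]
    simp only [Finsupp.weight_single, one_smul]
    exact sum_entryRank_perm_lt ha hb (Finset.ne_of_mem_erase hσ)

theorem monomial_mem_of_forall_isStd {d k₁ k₂ t : ℕ} {V : Submodule ℂ (MvP d k₁ k₂)}
    (hIV : (Iempty d k₁ k₂ t).restrictScalars ℂ ≤ V)
    (hstd : ∀ m, IsStd t m → monomial m 1 ∈ V) (m : Fin d × Col k₁ k₂ →₀ ℕ) :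
    monomial m 1 ∈ V := by
  induction hw : Finsupp.weight entryRank m using Nat.strong_induction_on generalizing m with
  | _ w ih =>
    subst hw
    by_cases hm : IsStd t m
    · exact hstd m hm
    rw [IsStd, not_and_or] at hm
    rcases hm with hm | hm
    · push Not at hm
      obtain ⟨x, hx, y, hy, hl, hi, hj⟩ := hm
      refine monomial_mem_of_minorPoly_mem (q := ![x, y]) hIV ?_ ?_ ?_ ?_
        fun m' h => ih _ h m' rfl
      · simpa [Fin.strictMono_iff_lt_succ] using hi
      · simpa [Fin.strictMono_iff_lt_succ, Prod.Lex.toLex_lt_toLex] using Or.inr ⟨hl, hj⟩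
      · refine Ideal.mem_sup_right (Ideal.mem_iSup_of_mem y.2.2 (Ideal.subset_span
          ⟨_, _, ?_, ?_, ?_, rfl⟩))
        · intro a b
          fin_cases a <;> fin_cases b <;> simp [hi.ne, hi.ne']
        · intro a b
          have : x.2 ≠ y.2 := fun h => hj.ne (congrArg Prod.fst h)
          fin_cases a <;> fin_cases b <;> simp [this, this.symm]
        · intro a
          fin_cases a
          · exact hl
          · rfl
      · intro a
        fin_cases a
        · exact hx
        · exact hy
    · push Not at hm
      obtain ⟨q, hq, hlt⟩ := hm
      have hb : StrictMono fun i => toLex ((q i).2.2, (q i).2.1) := fun a b hab =>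
        Prod.Lex.toLex_lt_toLex.mpr (Or.inl (hlt a b hab).2)
      refine monomial_mem_of_minorPoly_mem (q := q) hIV (fun a b hab => (hlt a b hab).1) hb ?_ hq
        fun m' h => ih _ h m' rfl
      have ha : StrictMono fun i => (q i).1 := fun a b hab => (hlt a b hab).1
      refine Ideal.mem_sup_left (Ideal.subset_span ⟨_, _, ha.injective, fun i j h => ?_,
        fun i => Set.mem_univ _, rfl⟩)
      exact hb.injective (congrArg (fun z : Col k₁ k₂ => toLex (z.2, z.1)) h)

/-- The exponent of a term in the parametrization: `x_{i,(j,ℓ)} ↦ ∑ₛ a_{i,s} b_{s,ℓ} w_{j,ℓ}`. -/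
def paramExp {d k₁ k₂ n : ℕ} (x : Fin d × Col k₁ k₂) (s : Fin n) :
    (Fin d × Fin n) ⊕ (Fin n × Fin k₂) ⊕ Col k₁ k₂ →₀ ℕ :=
  Finsupp.single (.inl (x.1, s)) 1 + Finsupp.single (.inr (.inl (s, x.2.2))) 1 +
    Finsupp.single (.inr (.inr x.2)) 1

/-- The parametrization of the matrices of rank at most `n` all of whose column slices have
rank at most one. -/
def param (d k₁ k₂ n : ℕ) :
    MvP d k₁ k₂ →ₐ[ℂ] MvPolynomial ((Fin d × Fin n) ⊕ (Fin n × Fin k₂) ⊕ Col k₁ k₂) ℂ :=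
  aeval fun x => ∑ s : Fin n, monomial (paramExp x s) 1

theorem param_monomial {d k₁ k₂ n N : ℕ} (p : Fin N → Fin d × Col k₁ k₂) :
    param d k₁ k₂ n (monomial (∑ k, Finsupp.single (p k) 1) 1) =
      ∑ c : Fin N → Fin n, monomial (∑ k, paramExp (p k) (c k)) 1 := by
  rw [monomial_sum_one, map_prod]
  have : ∀ k, param d k₁ k₂ n (monomial (Finsupp.single (p k) 1) 1) =
      ∑ s : Fin n, monomial (paramExp (p k) s) 1 := fun k => aeval_X _ _
  simp only [this]
  rw [Finset.prod_univ_sum, Fintype.piFinset_univ]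
  simp only [monomial_sum_one]

theorem coeff_param_monomial {d k₁ k₂ n N : ℕ} (p : Fin N → Fin d × Col k₁ k₂)
    (T : (Fin d × Fin n) ⊕ (Fin n × Fin k₂) ⊕ Col k₁ k₂ →₀ ℕ) :
    coeff T (param d k₁ k₂ n (monomial (∑ k, Finsupp.single (p k) 1) 1)) ≠ 0 ↔
      ∃ c : Fin N → Fin n, ∑ k, paramExp (p k) (c k) = T := by
  classical
  rw [param_monomial, coeff_sum]
  simp only [coeff_monomial, Finset.sum_boole, ne_eq, Nat.cast_eq_zero, Finset.card_eq_zero,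
    Finset.filter_eq_empty_iff, Finset.mem_univ, true_implies, not_forall, not_not]

open Finset in
theorem sum_paramExp_eq {d k₁ k₂ n : ℕ} {κ κ' : Type*} [Fintype κ] [Fintype κ']
    {p : κ → Fin d × Col k₁ k₂} {c : κ → Fin n} {p' : κ' → Fin d × Col k₁ k₂} {c' : κ' → Fin n}
    (h : ∑ k, paramExp (p k) (c k) = ∑ k, paramExp (p' k) (c' k)) :
    (∀ y, #{k | ((p k).1, c k) = y} = #{k | ((p' k).1, c' k) = y}) ∧
    (∀ y, #{k | (c k, (p k).2.2) = y} = #{k | (c' k, (p' k).2.2) = y}) ∧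
    (∀ y, #{k | (p k).2 = y} = #{k | (p' k).2 = y}) := by
  refine ⟨fun y => ?_, fun y => ?_, fun y => ?_⟩
  · simpa [paramExp, Finsupp.finsetSum_apply, Finsupp.single_apply] using
      DFunLike.congr_fun h (.inl y)
  · simpa [paramExp, Finsupp.finsetSum_apply, Finsupp.single_apply] using
      DFunLike.congr_fun h (.inr (.inl y))
  · simpa [paramExp, Finsupp.finsetSum_apply, Finsupp.single_apply] using
      DFunLike.congr_fun h (.inr (.inr y))

/-- Each standard monomial has a term in its image under the parametrization which determines
it among the monomials of smaller or equal weight. -/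
theorem IsStd.exists_coeff_param_ne_zero {d k₁ k₂ n : ℕ} {m : Fin d × Col k₁ k₂ →₀ ℕ}
    (hm : IsStd (n + 1) m) :
    ∃ T, coeff T (param d k₁ k₂ n (monomial m 1)) ≠ 0 ∧
      ∀ m', coeff T (param d k₁ k₂ n (monomial m' 1)) ≠ 0 →
        Finsupp.weight entryRank m' ≤ Finsupp.weight entryRank m → m' = m := by
  classical
  obtain ⟨N, p, rfl⟩ := exists_fin_sum_single_eq m
  have hp : ∀ k, p k ∈ (∑ k, Finsupp.single (p k) 1 : Fin d × Col k₁ k₂ →₀ ℕ).support := by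
    intro k
    rw [Finsupp.mem_support_iff, sum_single_one_apply, Finset.card_ne_zero]
    exact ⟨k, by simp⟩
  let r : Fin N → Fin N → Prop := fun k k' => (p k).1 < (p k').1 ∧ (p k).2.2 < (p k').2.2
  have : IsTrans (Fin N) r := ⟨fun _ _ _ h h' => ⟨h.1.trans h'.1, h.2.trans h'.2⟩⟩
  obtain ⟨c, hc⟩ := exists_coloring_of_no_chain r n fun q hq =>
    hm.2 (p ∘ q) (fun a => hp _) hq
  refine ⟨∑ k, paramExp (p k) (c k), (coeff_param_monomial _ _).mpr ⟨c, rfl⟩, fun m' h hw => ?_⟩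
  obtain ⟨N', p', rfl⟩ := exists_fin_sum_single_eq m'
  obtain ⟨c', hc'⟩ := (coeff_param_monomial _ _).mp h
  obtain ⟨hA, hB, hC⟩ := sum_paramExp_eq hc'.symm
  have hle := card_le_entryPos_le hA hB hC (fun k k' hk h1 h2 => hc k k' ⟨h1, h2⟩ hk)
    (fun k k' => hm.1 _ (hp k) _ (hp k'))
  simp only [map_sum, Finsupp.weight_single, one_smul, sum_entryRank] at hw
  have heq := (Finset.sum_eq_sum_iff_of_le fun y _ => hle y).mp
    (le_antisymm (Finset.sum_le_sum fun y _ => hle y) hw)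
  ext x
  rw [sum_single_one_apply, sum_single_one_apply]
  have := card_fiber_eq_of_card_le_eq (fun y => heq y (Finset.mem_univ y)) (entryPos x)
  simpa only [entryPos_injective.eq_iff] using this.symm

theorem param_injOn_isStd {d k₁ k₂ n : ℕ} {f : MvP d k₁ k₂}
    (hf : ∀ m ∈ f.support, IsStd (n + 1) m) (h : param d k₁ k₂ n f = 0) : f = 0 := by
  by_contra hne
  obtain ⟨m, hm, hmax⟩ := f.support.exists_max_image (Finsupp.weight entryRank)
    (support_nonempty.mpr hne)
  obtain ⟨T, hT, huniq⟩ := (hf m hm).exists_coeff_param_ne_zero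
  have hcoeff : coeff T (param d k₁ k₂ n f) =
      ∑ m' ∈ f.support, coeff m' f * coeff T (param d k₁ k₂ n (monomial m' 1)) := by
    conv_lhs => rw [f.as_sum]
    rw [map_sum, coeff_sum]
    refine Finset.sum_congr rfl fun m' _ => ?_
    rw [← mul_one (coeff m' f), ← smul_eq_mul, ← smul_monomial, map_smul, coeff_smul,
      smul_eq_mul, smul_eq_mul, mul_one]
  rw [h, coeff_zero, Finset.sum_eq_single_of_mem m hm] at hcoeff
  · exact (mul_ne_zero (mem_support_iff.mp hm) hT) hcoeff.symm
  · intro m' hm' hne'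
    by_contra hmul
    exact hne' (huniq m' (right_ne_zero_of_mul hmul) (hmax m' hm'))

theorem map_minorPoly {d k₁ k₂ r : ℕ} {R : Type*} [CommRing R] [Algebra ℂ R]
    (φ : MvP d k₁ k₂ →ₐ[ℂ] R) (a : Fin r → Fin d) (b : Fin r → Col k₁ k₂) :
    φ (minorPoly d k₁ k₂ r a b) = (Matrix.of fun i j => φ (X (a i, b j))).det := by
  rw [minorPoly, AlgHom.map_det]
  rfl

theorem det_mul_eq_zero_of_succ {R : Type*} [CommRing R] {n : ℕ}
    (A : Matrix (Fin (n + 1)) (Fin n) R) (B : Matrix (Fin n) (Fin (n + 1)) R) : (A * B).det = 0 := by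
  let A' : Matrix (Fin (n + 1)) (Fin (n + 1)) R :=
    Matrix.of fun i => Fin.snoc (α := fun _ => R) (A i) 0
  let B' : Matrix (Fin (n + 1)) (Fin (n + 1)) R :=
    Matrix.of fun s j => Fin.snoc (α := fun _ => R) (fun s => B s j) 0 s
  have : A * B = A' * B' := by
    ext i j
    rw [Matrix.mul_apply, Matrix.mul_apply, Fin.sum_univ_castSucc]
    simp [A', B']
  rw [this, Matrix.det_mul, Matrix.det_eq_zero_of_column_eq_zero (Fin.last n) (by simp [A']),
    zero_mul]

theorem param_X {d k₁ k₂ n : ℕ} (x : Fin d × Col k₁ k₂) :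
    param d k₁ k₂ n (X x) =
      (∑ s : Fin n, X (.inl (x.1, s)) * X (.inr (.inl (s, x.2.2)))) * X (.inr (.inr x.2)) := by
  rw [param, aeval_X, Finset.sum_mul]
  refine Finset.sum_congr rfl fun s _ => ?_
  simp only [paramExp, X, monomial_mul, mul_one]

theorem Iempty_le_ker_param (d k₁ k₂ n : ℕ) :
    Iempty d k₁ k₂ (n + 1) ≤ RingHom.ker (param d k₁ k₂ n) := by
  refine sup_le (Ideal.span_le.mpr ?_) (iSup_le fun j => Ideal.span_le.mpr ?_)
  · rintro _ ⟨a, b, -, -, -, rfl⟩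
    rw [SetLike.mem_coe, RingHom.mem_ker, map_minorPoly]
    rw [← det_mul_eq_zero_of_succ
      (Matrix.of fun i s => X (.inl (a i, s)) :
        Matrix (Fin (n + 1)) (Fin n)
          (MvPolynomial ((Fin d × Fin n) ⊕ (Fin n × Fin k₂) ⊕ Col k₁ k₂) ℂ))
      (Matrix.of fun s j => X (.inr (.inl (s, (b j).2))) * X (.inr (.inr (b j))))]
    congr 1
    ext1 i j
    simp only [Matrix.of_apply, param_X, Matrix.mul_apply, Finset.sum_mul, mul_assoc]
  · rintro _ ⟨a, b, -, -, hb, rfl⟩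
    rw [SetLike.mem_coe, RingHom.mem_ker, map_minorPoly, Matrix.det_fin_two]
    have h0 : (b 0).2 = j := hb 0
    have h1 : (b 1).2 = j := hb 1
    simp only [Matrix.of_apply, param_X, h0, h1]
    ring

/-- The ideal `I_∅` is the kernel of its parametrization. -/
theorem Iempty_eq_ker_param (d k₁ k₂ n : ℕ) :
    Iempty d k₁ k₂ (n + 1) = RingHom.ker (param d k₁ k₂ n) := by
  refine le_antisymm (Iempty_le_ker_param d k₁ k₂ n) fun f hf => ?_
  let S : Submodule ℂ (MvP d k₁ k₂) :=
    { carrier := {f | ∀ m, ¬ IsStd (n + 1) m → coeff m f = 0}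
      add_mem' := fun hf hg m hm => by rw [coeff_add, hf m hm, hg m hm, add_zero]
      zero_mem' := fun m _ => coeff_zero m
      smul_mem' := fun a f hf m hm => by rw [coeff_smul, hf m hm, smul_zero] }
  have hV : ∀ m, monomial m 1 ∈ (Iempty d k₁ k₂ (n + 1)).restrictScalars ℂ ⊔ S := by
    refine monomial_mem_of_forall_isStd le_sup_left fun m hm => Submodule.mem_sup_right fun m' hm' => ?_
    classical
    rw [coeff_monomial, if_neg]
    rintro rfl
    exact hm' hm
  have hfV : f ∈ (Iempty d k₁ k₂ (n + 1)).restrictScalars ℂ ⊔ S := by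
    rw [f.as_sum]
    refine Submodule.sum_mem _ fun m _ => ?_
    rw [← mul_one (coeff m f), ← smul_eq_mul, ← smul_monomial]
    exact Submodule.smul_mem _ _ (hV m)
  obtain ⟨g, hg, h, hh, rfl⟩ := Submodule.mem_sup.mp hfV
  have hker : param d k₁ k₂ n h = 0 := by
    have hg0 : param d k₁ k₂ n g = 0 := Iempty_le_ker_param d k₁ k₂ n hg
    rwa [RingHom.mem_ker, map_add, hg0, zero_add] at hf
  have : h = 0 := param_injOn_isStd (n := n)
    (fun m hm => by_contra fun hn => mem_support_iff.mp hm (hh m hn)) hker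
  rw [this, add_zero]
  exact hg

/-- for `2 ≤ k₁` and `2 ≤ t ≤ min(k₂, d)`, the ideal
`I_∅ = I_t(X) + Σ_j I_2(X_{C_j})` is prime. -/
theorem Iempty_isPrime
    (d k₁ k₂ t : ℕ) (hk₁ : 2 ≤ k₁) (ht : 2 ≤ t) (htk : t ≤ k₂) (htd : t ≤ d) :
    (Iempty d k₁ k₂ t).IsPrime := by
  obtain ⟨n, rfl⟩ : ∃ n, t = n + 1 := ⟨t - 1, by omega⟩
  rw [Iempty_eq_ker_param]
  exact RingHom.ker_isPrime _

end CI
end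
end

section
/- Let 2 ≤ k₁ and 2 ≤ t ≤ min(k₂, d). A matrix P ∈ ℂ^{d×(k₁k₂)}, with columns indexed by [k₁]×[k₂], can be written as P = M·N·D_A for some M ∈ ℂ^{d×(t−1)}, N ∈ ℂ^{(t−1)×k₂}, and A ∈ ℂ^{k₂×(k₁−1)} if and only if rank(P) ≤ t−1 and, for every j ∈ [k₂] and ℓ ∈ [k₁−1], the column of P indexed by (1+ℓ, j) is a scalar multiple of the column of P indexed by (1, j). -/
noncomputable section

open MvPolynomial

namespace CI

/-- A matrix of rank at most `r` factors through `K^r`. -/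
theorem exists_eq_mul_of_rank_le {K m n : Type*} [Field K] [Fintype m] [Fintype n]
    [DecidableEq n] {r : ℕ} (Q : Matrix m n K) (h : Q.rank ≤ r) :
    ∃ (M : Matrix m (Fin r) K) (N : Matrix (Fin r) n K), Q = M * N := by
  obtain ⟨f, hf⟩ := (finrank_le_iff_exists_linearMap (R := K)
    (M := LinearMap.range Q.mulVecLin) (M' := Fin r → K)).mp (by simpa [Matrix.rank] using h)
  obtain ⟨g, hg⟩ := f.exists_leftInverse_of_injective (LinearMap.ker_eq_bot.mpr hf)
  refine ⟨LinearMap.toMatrix' ((LinearMap.range Q.mulVecLin).subtype ∘ₗ g),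
    LinearMap.toMatrix' (f ∘ₗ Q.mulVecLin.rangeRestrict), ?_⟩
  have hcomp : ((LinearMap.range Q.mulVecLin).subtype ∘ₗ g) ∘ₗ
      (f ∘ₗ Q.mulVecLin.rangeRestrict) = Matrix.toLin' Q := by
    rw [LinearMap.comp_assoc, ← LinearMap.comp_assoc _ f g, hg]
    rfl
  rw [← LinearMap.toMatrix'_comp, hcomp, LinearMap.toMatrix'_toLin']

theorem mul_DMat_apply {m : Type*} {k₁ k₂ : ℕ} (Q : Matrix m (Fin k₂) ℂ)
    (A : Matrix (Fin k₂) (Fin (k₁ - 1)) ℂ) (i : m) (c : Col k₁ k₂) :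
    (Q * DMat k₁ k₂ A) i c = Q i c.2 * DMat k₁ k₂ A c.2 c := by
  rw [Matrix.mul_apply]
  exact Fintype.sum_eq_single _ fun r hr => by simp [DMat, hr.symm]

/-- for `2 ≤ k₁` and `2 ≤ t ≤ min(k₂, d)`, a matrix
`P ∈ ℂ^{d×(k₁k₂)}` factors as `P = M·N·D_A` iff `rank P ≤ t − 1` and each column
indexed by `(1+ℓ, j)` is a scalar multiple of the column indexed by `(1, j)`. -/
theorem factorization_iff_rank_and_collinear
    (d k₁ k₂ t : ℕ) (hk₁ : 2 ≤ k₁) (ht : 2 ≤ t) (htk : t ≤ k₂) (htd : t ≤ d)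
    (P : Matrix (Fin d) (Col k₁ k₂) ℂ) :
    (∃ (M : Matrix (Fin d) (Fin (t - 1)) ℂ) (N : Matrix (Fin (t - 1)) (Fin k₂) ℂ)
        (A : Matrix (Fin k₂) (Fin (k₁ - 1)) ℂ), P = M * N * DMat k₁ k₂ A) ↔
      (P.rank ≤ t - 1 ∧
        ∀ (j : Fin k₂) (ℓ : Fin (k₁ - 1)), ∃ c : ℂ, ∀ i : Fin d,
          P i (⟨(ℓ : ℕ) + 1, by have := ℓ.isLt; omega⟩, j) =
            c * P i (⟨0, by omega⟩, j)) := by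
  constructor
  · rintro ⟨M, N, A, rfl⟩
    refine ⟨?_, fun j ℓ => ⟨A j ℓ, fun i => ?_⟩⟩
    · rw [Matrix.mul_assoc]
      exact (Matrix.rank_mul_le_left _ _).trans (Matrix.rank_le_width M)
    · simp [mul_DMat_apply, DMat, mul_comm]
  · rintro ⟨hrank, hcol⟩
    choose A hA using hcol
    obtain ⟨M, N, hMN⟩ := exists_eq_mul_of_rank_le
      (P.submatrix id fun j : Fin k₂ => ((⟨0, by omega⟩, j) : Col k₁ k₂))
      ((Matrix.rank_submatrix_le _ _ _).trans hrank)
    refine ⟨M, N, Matrix.of A, ?_⟩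
    rw [← hMN]
    ext i ⟨⟨a, ha⟩, j⟩
    rw [mul_DMat_apply]
    cases a with
    | zero => simp [DMat]
    | succ a => simpa [DMat] using (hA j ⟨a, by omega⟩ i).trans (mul_comm _ _)

end CI
end
end
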